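/- For c > 0 with c ≠ 1 and every δ ∈ (0,1), locally uniformly for x and y in (-δ, δ), lim_{n→∞} (π/n)·Kₙ(πx/n, πy/n) = K_∞(x,y), where K_∞(x,y) = (1/(h(0)·πi))·(log c/(c²−1))·[G(1+λ; 2πix)·G(λ; 2πiy) − G(1+λ; 2πiy)·G(λ; 2πix)]/(x−y) for x ≠ y, and K_∞(x,x) = (2/h(0))·(log c/(c²−1))·(G'(1+λ; 2πix)·G(λ; 2πix) − G(1+λ; 2πix)·G'(λ; 2πix)), with G' denoting the derivative of G(a;ζ) with respect to ζ. -/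

import Mathlib

open Filter Set MeasureTheory

/-- `G(a;ζ) = e^{-ζ/2} ∑_{k≥0} ((a)_k/(k!)²) ζ^k`, where `(a)_k` is the Pochhammer symbol. -/
noncomputable def Gfun (a ζ : ℂ) : ℂ :=
  Complex.exp (-ζ / 2) *
    ∑' k : ℕ, ((ascPochhammer ℂ k).eval a / ((Nat.factorial k : ℂ)) ^ 2) * ζ ^ k

/-- `λ = i·log(c)/π`. -/
noncomputable def lamC (c : ℝ) : ℂ := Complex.I * ((Real.log c / Real.pi : ℝ) : ℂ)

theorem ascPochhammer_succ_eval_left (k : ℕ) (a : ℂ) :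
    (ascPochhammer ℂ (k + 1)).eval a = a * (ascPochhammer ℂ k).eval (a + 1) := by
  simp [ascPochhammer_succ_left, Polynomial.eval_comp]

theorem ascPochhammer_eval_ne_zero {s : ℂ} (hs : s.im ≠ 0) (k : ℕ) :
    (ascPochhammer ℂ k).eval s ≠ 0 := by
  induction k with
  | zero => simp
  | succ k ih =>
    rw [ascPochhammer_succ_eval]
    refine mul_ne_zero ih fun h => hs ?_
    simpa using congrArg Complex.im h

/-- Chu–Vandermonde in the form used for a Cauchy-type moment functional. -/
theorem sum_choose_mul_ascPochhammer_div (N : ℕ) {a s : ℂ} (hs : s.im ≠ 0) :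
    ∑ k ∈ Finset.range (N + 1), (-1 : ℂ) ^ k * (N.choose k) * (ascPochhammer ℂ k).eval a /
        (ascPochhammer ℂ (k + 1)).eval s =
      (ascPochhammer ℂ N).eval (s + 1 - a) / (ascPochhammer ℂ (N + 1)).eval s := by
  induction N generalizing a s with
  | zero => simp
  | succ N ih =>
    have hs1 : (s + 1).im ≠ 0 := by simpa using hs
    have hs0 : s ≠ 0 := by rintro rfl; simp at hs
    have e1 := ih (a := a) hs
    have e2 := ih (a := a + 1) hs1
    have key : ∑ k ∈ Finset.range (N + 1 + 1), (-1 : ℂ) ^ k * ((N + 1).choose k) *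
          (ascPochhammer ℂ k).eval a / (ascPochhammer ℂ (k + 1)).eval s =
        ∑ k ∈ Finset.range (N + 1), (-1 : ℂ) ^ k * (N.choose k) * (ascPochhammer ℂ k).eval a /
          (ascPochhammer ℂ (k + 1)).eval s - a / s *
        ∑ k ∈ Finset.range (N + 1), (-1 : ℂ) ^ k * (N.choose k) *
          (ascPochhammer ℂ k).eval (a + 1) / (ascPochhammer ℂ (k + 1)).eval (s + 1) := by
      rw [Finset.sum_range_succ' _ (N + 1)]
      have h1 : ∑ k ∈ Finset.range (N + 1), (-1 : ℂ) ^ k * (N.choose k) *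
          (ascPochhammer ℂ k).eval a / (ascPochhammer ℂ (k + 1)).eval s =
          ∑ k ∈ Finset.range (N + 1 + 1), (-1 : ℂ) ^ k * (N.choose k) *
          (ascPochhammer ℂ k).eval a / (ascPochhammer ℂ (k + 1)).eval s := by
        rw [Finset.sum_range_succ _ (N + 1)]; simp
      rw [h1, Finset.sum_range_succ' _ (N + 1), Finset.mul_sum, add_sub_right_comm,
        ← Finset.sum_sub_distrib]
      congr 1
      · refine Finset.sum_congr rfl fun k _ => ?_
        rw [Nat.choose_succ_succ, ascPochhammer_succ_eval_left k a,
          ascPochhammer_succ_eval_left (k + 1) s]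
        have := ascPochhammer_eval_ne_zero hs1 (k + 1)
        push_cast
        field_simp
        ring
      · simp
    rw [key, e1, e2, show s + 1 + 1 - (a + 1) = s + 1 - a by ring,
      ascPochhammer_succ_eval N (s + 1 - a),
      ascPochhammer_succ_eval_left (N + 1) s]
    have h3 := ascPochhammer_succ_eval_left N s
    have h4 := ascPochhammer_succ_eval N (s + 1)
    rw [h3, h4]
    have h5 := ascPochhammer_eval_ne_zero hs1 N
    have h6 : s + 1 + N ≠ 0 := fun h => hs1 (by simpa using congrArg Complex.im h)
    field_simp
    ring

/-- The terminating series `₂F₁(-N, a; 1; 1 - z)`. -/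
noncomputable def szegoPoly (N : ℕ) (a z : ℂ) : ℂ :=
  ∑ k ∈ Finset.range (N + 1),
    (-1 : ℂ) ^ k * (N.choose k) * (ascPochhammer ℂ k).eval a / (k.factorial : ℂ) * (1 - z) ^ k

theorem szegoPoly_eq_sum_of_le {N K : ℕ} (h : N ≤ K) (a z : ℂ) :
    szegoPoly N a z = ∑ k ∈ Finset.range (K + 1),
    (-1 : ℂ) ^ k * (N.choose k) * (ascPochhammer ℂ k).eval a / (k.factorial : ℂ) * (1 - z) ^ k := by
  refine Finset.sum_subset (Finset.range_mono (by omega)) fun k _ hk => ?_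
  rw [Nat.choose_eq_zero_of_lt (by simpa using hk)]
  simp

theorem mul_szegoPoly (N : ℕ) (a z : ℂ) :
    z * szegoPoly N a z = 1 + ∑ k ∈ Finset.range (N + 1),
      (-1 : ℂ) ^ (k + 1) / ((k + 1).factorial : ℂ) * (N.choose (k + 1) *
        (ascPochhammer ℂ (k + 1)).eval a + (k + 1) * N.choose k * (ascPochhammer ℂ k).eval a) *
        (1 - z) ^ (k + 1) := by
  have h1 := szegoPoly_eq_sum_of_le (Nat.le_succ N) a z
  rw [Finset.sum_range_succ'] at h1
  have h2 : z * szegoPoly N a z = szegoPoly N a z - (1 - z) * szegoPoly N a z := by ring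
  rw [h2]
  nth_rewrite 2 [szegoPoly]
  rw [h1, Finset.mul_sum]
  simp only [pow_zero, Nat.choose_zero_right, Nat.factorial_zero, one_mul,
    Nat.cast_one, ascPochhammer_zero, Polynomial.eval_one, div_one]
  rw [add_sub_right_comm, ← Finset.sum_sub_distrib, add_comm]
  congr 1
  refine Finset.sum_congr rfl fun k _ => ?_
  rw [Nat.factorial_succ]
  have : (k.factorial : ℂ) ≠ 0 := by exact_mod_cast k.factorial_ne_zero
  have : (k + 1 : ℂ) ≠ 0 := by exact_mod_cast k.succ_ne_zero
  push_cast
  field_simp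
  ring

theorem szegoPoly_succ (N : ℕ) (l z : ℂ) :
    (N + 1) * szegoPoly (N + 1) (1 + l) z =
      (1 + l + N) * (z * szegoPoly N (1 + l) z) - l * szegoPoly N l z := by
  rw [mul_szegoPoly, szegoPoly, szegoPoly_eq_sum_of_le (Nat.le_succ N) l z,
    Finset.sum_range_succ', Finset.sum_range_succ' _ (N + 1)]
  simp only [mul_add, Finset.mul_sum, pow_zero, Nat.choose_zero_right, Nat.factorial_zero,
    Nat.cast_one, ascPochhammer_zero, Polynomial.eval_one, div_one, mul_one]
  rw [show ∀ A B C D E F : ℂ, (A + B = C + D - (E + F)) ↔ (A = D - E + (C - F - B)) from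
    fun A B C D E F => ⟨fun h => by linear_combination h, fun h => by linear_combination h⟩,
    show (1 + l + N - l - (N + 1) : ℂ) = 0 by ring, add_zero, ← Finset.sum_sub_distrib]
  refine Finset.sum_congr rfl fun k _ => ?_
  rw [ascPochhammer_succ_eval_left k l, ascPochhammer_succ_eval k (1 + l), add_comm l 1,
    Nat.choose_succ_succ]
  have h : ((N.choose (k + 1) : ℂ)) * (k + 1) = N.choose k * (N - k) := by
    rcases le_or_gt k N with hk | hk
    · have := Nat.choose_succ_right_eq N k
      rw [← Nat.cast_sub hk]
      exact_mod_cast this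
    · simp [Nat.choose_eq_zero_of_lt hk, Nat.choose_eq_zero_of_lt (Nat.lt_succ_of_lt hk)]
  push_cast
  linear_combination (-(-1) ^ (k + 1) * (1 - z) ^ (k + 1) / ((k + 1).factorial : ℂ) *
    (ascPochhammer ℂ k).eval (1 + l) * l) * h

theorem szegoPoly_succ' (N : ℕ) (l z : ℂ) :
    (N + 1) * szegoPoly (N + 1) l z =
      (N + 1 - l) * szegoPoly N l z + l * (z * szegoPoly N (1 + l) z) := by
  rw [mul_szegoPoly, szegoPoly, szegoPoly_eq_sum_of_le (Nat.le_succ N) l z,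
    Finset.sum_range_succ', Finset.sum_range_succ' _ (N + 1)]
  simp only [mul_add, Finset.mul_sum, pow_zero, Nat.choose_zero_right, Nat.factorial_zero,
    Nat.cast_one, ascPochhammer_zero, Polynomial.eval_one, div_one, mul_one]
  rw [show ∀ A B C D E F : ℂ, (A + B = C + D + (E + F)) ↔ (A = C + F + (D + E - B)) from
    fun A B C D E F => ⟨fun h => by linear_combination h, fun h => by linear_combination h⟩,
    show (N + 1 - l + l - (N + 1) : ℂ) = 0 by ring, add_zero, ← Finset.sum_add_distrib]
  refine Finset.sum_congr rfl fun k _ => ?_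
  rw [ascPochhammer_succ_eval_left k l, ascPochhammer_succ_eval k (1 + l), add_comm l 1,
    Nat.choose_succ_succ]
  have h : ((N.choose (k + 1) : ℂ)) * (k + 1) = N.choose k * (N - k) := by
    rcases le_or_gt k N with hk | hk
    · have := Nat.choose_succ_right_eq N k
      rw [← Nat.cast_sub hk]
      exact_mod_cast this
    · simp [Nat.choose_eq_zero_of_lt hk, Nat.choose_eq_zero_of_lt (Nat.lt_succ_of_lt hk)]
  push_cast
  linear_combination (-(-1) ^ (k + 1) * (1 - z) ^ (k + 1) / ((k + 1).factorial : ℂ) *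
    (ascPochhammer ℂ k).eval (1 + l) * l) * h

/-- The unnormalised Christoffel–Darboux kernel built from `szegoPoly`. -/
noncomputable def szegoKernel (l : ℂ) : ℕ → ℂ → ℂ → ℂ
  | 0, _, _ => 0
  | N + 1, z, w => w * szegoKernel l N z w + szegoPoly N l w * szegoPoly N (1 + l) z

theorem sub_mul_szegoKernel (l : ℂ) (N : ℕ) (z w : ℂ) :
    (z - w) * szegoKernel l N z w =
      szegoPoly N l w * szegoPoly N (1 + l) z - szegoPoly N (1 + l) w * szegoPoly N l z := by
  induction N with
  | zero => simp [szegoKernel, szegoPoly]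
  | succ N ih =>
    have a1 := szegoPoly_succ N l z
    have a2 := szegoPoly_succ N l w
    have b1 := szegoPoly_succ' N l z
    have b2 := szegoPoly_succ' N l w
    have h0 : ((N : ℂ) + 1) ≠ 0 := by exact_mod_cast N.succ_ne_zero
    have key : ((N : ℂ) + 1) ^ 2 * ((z - w) * szegoKernel l (N + 1) z w) = ((N : ℂ) + 1) ^ 2 *
        (szegoPoly (N + 1) l w * szegoPoly (N + 1) (1 + l) z -
          szegoPoly (N + 1) (1 + l) w * szegoPoly (N + 1) l z) := by
      have : ((N : ℂ) + 1) ^ 2 * (szegoPoly (N + 1) l w * szegoPoly (N + 1) (1 + l) z -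
          szegoPoly (N + 1) (1 + l) w * szegoPoly (N + 1) l z) =
          (((N : ℂ) + 1) * szegoPoly (N + 1) l w) * (((N : ℂ) + 1) * szegoPoly (N + 1) (1 + l) z) -
          (((N : ℂ) + 1) * szegoPoly (N + 1) (1 + l) w) *
            (((N : ℂ) + 1) * szegoPoly (N + 1) l z) := by ring
      rw [this, a1, a2, b1, b2, szegoKernel]
      linear_combination ((N : ℂ) + 1) ^ 2 * w * ih
    exact mul_left_cancel₀ (pow_ne_zero 2 h0) key

/-- The weight on one period of the circle with a single jump at the origin. -/
noncomputable def circWeight (b c φ : ℝ) : ℝ :=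
  b * (if φ < 0 then 1 else c ^ 2) * Real.exp (-(Real.log c / Real.pi) * φ)

noncomputable def circMeasure (b c : ℝ) : Measure ℝ :=
  (volume.restrict (Ioo (-(Real.pi / 2)) (3 * Real.pi / 2))).withDensity
    fun φ => ENNReal.ofReal (circWeight b c φ)

theorem circWeight_measurable (b c : ℝ) : Measurable (circWeight b c) := by
  unfold circWeight
  refine ((measurable_const.mul ?_).mul (by fun_prop))
  exact Measurable.ite measurableSet_Iio measurable_const measurable_const

theorem circWeight_pos {b c : ℝ} (hb : 0 < b) (hc : 0 < c) (φ : ℝ) : 0 < circWeight b c φ := by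
  unfold circWeight
  have : 0 < (if φ < 0 then 1 else c ^ 2 : ℝ) := by split_ifs <;> positivity
  positivity

theorem exists_circWeight_le {b c : ℝ} (hb : 0 < b) (hc : 0 < c) :
    ∃ C, 0 < C ∧ ∀ φ ∈ Icc (-(Real.pi / 2)) (3 * Real.pi / 2), circWeight b c φ ≤ C ∧
      C⁻¹ ≤ circWeight b c φ := by
  obtain ⟨M, hM⟩ : ∃ M, ∀ φ ∈ Icc (-(Real.pi / 2)) (3 * Real.pi / 2),
      |-(Real.log c / Real.pi) * φ| ≤ M := by
    obtain ⟨M, hM⟩ := (isCompact_Icc (a := -(Real.pi / 2)) (b := 3 * Real.pi / 2)).exists_bound_of_continuousOn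
      (f := fun φ => -(Real.log c / Real.pi) * φ) (by fun_prop)
    exact ⟨M, hM⟩
  refine ⟨max (b * (1 + c ^ 2) * Real.exp M) (b⁻¹ * (1 + (c ^ 2)⁻¹) * Real.exp M), by positivity,
    fun φ hφ => ⟨?_, ?_⟩⟩
  · refine le_trans ?_ (le_max_left _ _)
    unfold circWeight
    gcongr
    · split_ifs <;> nlinarith [sq_nonneg c]
    · exact (abs_le.1 (hM φ hφ)).2
  · refine inv_le_of_inv_le₀ (circWeight_pos hb hc φ) (le_trans ?_ (le_max_right _ _))
    unfold circWeight
    rw [mul_inv, mul_inv, ← Real.exp_neg]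
    have : 0 < c ^ 2 := by positivity
    gcongr
    · split_ifs
      · simpa using this.le
      · simp
    · linarith [(abs_le.1 (hM φ hφ)).1]

theorem exists_circMeasure_le {b c : ℝ} (hb : 0 < b) (hc : 0 < c) :
    ∃ C : ENNReal, C ≠ ⊤ ∧ circMeasure b c ≤
      C • volume.restrict (Icc (-(Real.pi / 2)) (3 * Real.pi / 2)) := by
  obtain ⟨C, hC, h⟩ := exists_circWeight_le hb hc
  refine ⟨ENNReal.ofReal C, ENNReal.ofReal_ne_top, ?_⟩
  have hle : ENNReal.ofReal C • volume.restrict (Ioo (-(Real.pi / 2)) (3 * Real.pi / 2)) ≤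
      ENNReal.ofReal C • volume.restrict (Icc (-(Real.pi / 2)) (3 * Real.pi / 2)) := by
    refine Measure.le_intro fun s _ _ => ?_
    rw [Measure.smul_apply, Measure.smul_apply, smul_eq_mul, smul_eq_mul]
    gcongr
    exact Ioo_subset_Icc_self
  refine le_trans ?_ hle
  rw [← withDensity_const]
  refine withDensity_mono ?_
  filter_upwards [ae_restrict_mem measurableSet_Ioo] with φ hφ
  exact ENNReal.ofReal_le_ofReal (h φ (Ioo_subset_Icc_self hφ)).1

theorem Continuous.integrable_circMeasure {E : Type*} [NormedAddCommGroup E] {b c : ℝ}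
    (hb : 0 < b) (hc : 0 < c) {f : ℝ → E}
    (hf : Continuous f) : Integrable f (circMeasure b c) := by
  obtain ⟨C, hC, h⟩ := exists_circMeasure_le hb hc
  exact ((hf.integrableOn_Icc (a := -(Real.pi / 2)) (b := 3 * Real.pi / 2)).smul_measure hC).mono_measure h

theorem integral_circMeasure {E : Type*} [NormedAddCommGroup E] [NormedSpace ℝ E] {b c : ℝ}
    (hb : 0 < b) (hc : 0 < c) (f : ℝ → E) :
    ∫ φ, f φ ∂(circMeasure b c) =
      ∫ φ in Ioo (-(Real.pi / 2)) (3 * Real.pi / 2), circWeight b c φ • f φ := by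
  unfold circMeasure
  rw [integral_withDensity_eq_integral_toReal_smul (circWeight_measurable b c).ennreal_ofReal
    (by simp)]
  simp only [ENNReal.toReal_ofReal (circWeight_pos hb hc _).le]

theorem integral_exp_circMeasure {b c : ℝ} (hb : 0 < b) (hc : 0 < c) (hc1 : c ≠ 1) (k : ℤ) :
    ∫ φ, Complex.exp (Complex.I * k * φ) ∂(circMeasure b c) =
      Complex.I * (b * (c ^ 2 - 1)) / (k + lamC c) := by
  have hlog : Real.log c ≠ 0 := Real.log_ne_zero_of_pos_of_ne_one hc hc1
  have hpi := Real.pi_pos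
  have hpi' : (Real.pi : ℂ) ≠ 0 := by exact_mod_cast hpi.ne'
  set τ : ℝ := Real.log c / Real.pi with hτ
  have hτ0 : τ ≠ 0 := div_ne_zero hlog hpi.ne'
  set s : ℂ := Complex.I * k - τ with hs
  have hs0 : s ≠ 0 := fun h => hτ0 (by simpa [hs] using congrArg Complex.re h)
  rw [integral_circMeasure hb hc, ← integral_Ioc_eq_integral_Ioo,
    ← intervalIntegral.integral_of_le (by linarith)]
  have e1 : ∀ φ : ℝ, circWeight b c φ • Complex.exp (Complex.I * k * φ) =
      (b * (if φ < 0 then 1 else c ^ 2 : ℝ) : ℝ) * Complex.exp (s * φ) := by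
    intro φ
    rw [circWeight, Complex.real_smul, Complex.ofReal_mul, Complex.ofReal_exp, mul_assoc,
      ← Complex.exp_add]
    congr 2
    rw [hs, ← hτ]; push_cast; ring
  simp only [e1]
  have i1 : ∫ φ in (-(Real.pi / 2))..0, ((b * (if φ < 0 then 1 else c ^ 2 : ℝ) : ℝ) : ℂ) *
      Complex.exp (s * φ) = ∫ φ in (-(Real.pi / 2))..0, (b : ℂ) * Complex.exp (s * φ) := by
    rw [intervalIntegral.integral_of_le (by linarith), intervalIntegral.integral_of_le (by linarith),
      integral_Ioc_eq_integral_Ioo, integral_Ioc_eq_integral_Ioo]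
    refine setIntegral_congr_fun measurableSet_Ioo fun φ hφ => ?_
    simp [hφ.2]
  have i2 : ∫ φ in (0)..(3 * Real.pi / 2), ((b * (if φ < 0 then 1 else c ^ 2 : ℝ) : ℝ) : ℂ) *
      Complex.exp (s * φ) = ∫ φ in (0)..(3 * Real.pi / 2), ((b * c ^ 2 : ℝ) : ℂ) * Complex.exp (s * φ) := by
    rw [intervalIntegral.integral_of_le (by positivity), intervalIntegral.integral_of_le (by positivity)]
    refine setIntegral_congr_fun measurableSet_Ioc fun φ hφ => ?_
    simp [not_lt.2 hφ.1.le]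
  have int : ∀ x y : ℝ, IntervalIntegrable (fun φ : ℝ =>
      ((b * (if φ < 0 then 1 else c ^ 2 : ℝ) : ℝ) : ℂ) * Complex.exp (s * φ)) volume x y := by
    intro x y
    refine IntervalIntegrable.mul_continuousOn ?_ (by fun_prop)
    have hcont : IntervalIntegrable (fun _ : ℝ => (b * (1 + c ^ 2) : ℝ)) volume x y := by simp
    refine hcont.mono_fun ?_ ?_
    · refine Measurable.aestronglyMeasurable ?_
      refine Complex.measurable_ofReal.comp (measurable_const.mul ?_)
      exact Measurable.ite measurableSet_Iio measurable_const measurable_const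
    · refine Eventually.of_forall fun φ => ?_
      simp only [Complex.norm_real, norm_mul]
      gcongr
      split_ifs <;> simp only [Real.norm_eq_abs] <;> rw [abs_of_pos (by positivity), abs_of_pos (by positivity)] <;>
        nlinarith [sq_nonneg c]
  rw [← intervalIntegral.integral_add_adjacent_intervals (int _ 0) (int 0 _), i1, i2,
    intervalIntegral.integral_const_mul, intervalIntegral.integral_const_mul,
    integral_exp_mul_complex hs0, integral_exp_mul_complex hs0]
  have x1 : Complex.exp (s * (3 * Real.pi / 2 : ℝ)) =
      Complex.exp (s * (-(Real.pi / 2) : ℝ)) * ((c ^ 2 : ℝ) : ℂ)⁻¹ := by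
    have : ((c ^ 2 : ℝ) : ℂ)⁻¹ = Complex.exp (-(2 * τ * Real.pi)) := by
      rw [Complex.exp_neg]
      congr 1
      have : c ^ 2 = Real.exp (2 * τ * Real.pi) := by
        rw [hτ, mul_assoc, div_mul_cancel₀ _ hpi.ne', two_mul, Real.exp_add, Real.exp_log hc, sq]
      rw [this]; push_cast; rfl
    rw [this, ← Complex.exp_add]
    rw [show s * (3 * Real.pi / 2 : ℝ) = (s * (-(Real.pi / 2) : ℝ) + -(2 * τ * Real.pi)) +
      (k : ℂ) * (2 * Real.pi * Complex.I) by rw [hs]; push_cast; ring]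
    rw [Complex.exp_add _ ((k : ℂ) * _), Complex.exp_int_mul_two_pi_mul_I, mul_one]
  rw [x1]
  have hc' : (c : ℂ) ≠ 0 := by exact_mod_cast hc.ne'
  have hk : (k : ℂ) + lamC c = -Complex.I * s := by
    rw [hs, lamC, mul_sub, neg_mul, neg_mul, ← mul_assoc, Complex.I_mul_I]; ring
  rw [hk]
  push_cast
  have hI := Complex.I_ne_zero
  field_simp
  simp
  ring

theorem lamC_im {c : ℝ} (hc : 0 < c) (hc1 : c ≠ 1) : (lamC c).im ≠ 0 := by
  have hlog : Real.log c ≠ 0 := Real.log_ne_zero_of_pos_of_ne_one hc hc1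
  have : (lamC c).im = Real.log c / Real.pi := by simp [lamC, -Complex.ofReal_div]
  rw [this]
  exact div_ne_zero hlog Real.pi_ne_zero

theorem integral_one_sub_exp_pow {b c : ℝ} (hb : 0 < b) (hc : 0 < c) (hc1 : c ≠ 1) (k : ℕ) (j : ℤ) :
    ∫ φ : ℝ, (1 - Complex.exp (Complex.I * φ)) ^ k * Complex.exp (-(Complex.I * j * φ))
        ∂(circMeasure b c) =
      Complex.I * (b * (c ^ 2 - 1)) * (k.factorial / (ascPochhammer ℂ (k + 1)).eval (lamC c - j)) := by
  induction k generalizing j with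
  | zero =>
    have := integral_exp_circMeasure hb hc hc1 (-j)
    push_cast at this
    simp only [mul_neg, neg_mul] at this
    simp only [pow_zero, one_mul, this, zero_add, ascPochhammer_one, Polynomial.eval_X]
    rw [show -(j : ℂ) + lamC c = lamC c - j by ring]
    simp [div_eq_mul_inv]
  | succ k ih =>
    have h1 : ∀ φ : ℝ, (1 - Complex.exp (Complex.I * φ)) ^ (k + 1) *
        Complex.exp (-(Complex.I * j * φ)) =
        (1 - Complex.exp (Complex.I * φ)) ^ k * Complex.exp (-(Complex.I * j * φ)) -
        (1 - Complex.exp (Complex.I * φ)) ^ k * Complex.exp (-(Complex.I * ((j - 1 : ℤ) : ℂ) * φ)) := by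
      intro φ
      have : Complex.exp (-(Complex.I * ((j - 1 : ℤ) : ℂ) * φ)) =
          Complex.exp (-(Complex.I * j * φ)) * Complex.exp (Complex.I * φ) := by
        rw [← Complex.exp_add]; congr 1; push_cast; ring
      rw [this]; ring
    simp only [h1]
    rw [integral_sub (Continuous.integrable_circMeasure hb hc (by fun_prop))
      (Continuous.integrable_circMeasure hb hc (by fun_prop)), ih, ih]
    have hs : (lamC c - j).im ≠ 0 := by simpa using lamC_im hc hc1
    rw [show lamC c - ((j - 1 : ℤ) : ℂ) = lamC c - j + 1 by push_cast; ring]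
    generalize lamC c - (j : ℂ) = s at hs ⊢
    have hs1 : (s + 1).im ≠ 0 := by simpa using hs
    have hs0 : s ≠ 0 := by rintro rfl; simp at hs
    rw [ascPochhammer_succ_eval_left k s, ascPochhammer_succ_eval_left (k + 1) s,
      ascPochhammer_succ_eval k (s + 1), Nat.factorial_succ]
    have h5 := ascPochhammer_eval_ne_zero hs1 k
    have h6 : s + 1 + k ≠ 0 := fun h => hs1 (by simpa using congrArg Complex.im h)
    push_cast
    field_simp
    ring

theorem continuous_szegoPoly (N : ℕ) (a : ℂ) : Continuous (szegoPoly N a) := by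
  unfold szegoPoly; fun_prop

theorem integral_szegoPoly {b c : ℝ} (hb : 0 < b) (hc : 0 < c) (hc1 : c ≠ 1) (N : ℕ) (a : ℂ)
    (j : ℤ) :
    ∫ φ : ℝ, szegoPoly N a (Complex.exp (Complex.I * φ)) * Complex.exp (-(Complex.I * j * φ))
        ∂(circMeasure b c) =
      Complex.I * (b * (c ^ 2 - 1)) * ((ascPochhammer ℂ N).eval (lamC c - j + 1 - a) /
        (ascPochhammer ℂ (N + 1)).eval (lamC c - j)) := by
  have hs : (lamC c - j).im ≠ 0 := by simpa using lamC_im hc hc1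
  rw [← sum_choose_mul_ascPochhammer_div N hs, Finset.mul_sum]
  simp only [szegoPoly, Finset.sum_mul]
  rw [integral_finsetSum _ fun k _ => Continuous.integrable_circMeasure hb hc (by fun_prop)]
  refine Finset.sum_congr rfl fun k _ => ?_
  simp only [mul_assoc]
  have h := integral_one_sub_exp_pow hb hc hc1 k j
  simp only [mul_assoc] at h
  have hk : (k.factorial : ℂ) ≠ 0 := by exact_mod_cast k.factorial_ne_zero
  simp only [div_eq_mul_inv, mul_assoc]
  rw [integral_const_mul, integral_const_mul, integral_const_mul, integral_const_mul, h]
  field_simp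

theorem integral_szegoPoly_one_add {b c : ℝ} (hb : 0 < b) (hc : 0 < c) (hc1 : c ≠ 1) {N j : ℕ}
    (hj : j < N) :
    ∫ φ : ℝ, szegoPoly N (1 + lamC c) (Complex.exp (Complex.I * φ)) *
      Complex.exp (-(Complex.I * j * φ)) ∂(circMeasure b c) = 0 := by
  have h := integral_szegoPoly hb hc hc1 N (1 + lamC c) j
  rw [show lamC c - ((j : ℤ) : ℂ) + 1 - (1 + lamC c) = -(j : ℂ) by push_cast; ring,
    ascPochhammer_eval_neg_coe_nat_of_lt hj] at h
  simpa using h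

theorem integral_szegoPoly_lamC {b c : ℝ} (hb : 0 < b) (hc : 0 < c) (hc1 : c ≠ 1) {N j : ℕ}
    (hj : j < N) :
    ∫ φ : ℝ, szegoPoly N (lamC c) (Complex.exp (Complex.I * φ)) *
      Complex.exp (-(Complex.I * (j + 1) * φ)) ∂(circMeasure b c) = 0 := by
  have h := integral_szegoPoly hb hc hc1 N (lamC c) (j + 1)
  rw [show lamC c - ((j + 1 : ℤ) : ℂ) + 1 - lamC c = -(j : ℂ) by push_cast; ring,
    ascPochhammer_eval_neg_coe_nat_of_lt hj] at h
  simpa using h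

theorem continuous_szegoKernel (l : ℂ) (N : ℕ) (w : ℂ) :
    Continuous fun z => szegoKernel l N z w := by
  induction N with
  | zero => simpa [szegoKernel] using continuous_const
  | succ N ih =>
    have := continuous_szegoPoly N (1 + l)
    simp only [szegoKernel]
    fun_prop

theorem integral_szegoKernel {b c : ℝ} (hb : 0 < b) (hc : 0 < c) (hc1 : c ≠ 1) (w : ℂ) {N j : ℕ}
    (hj : j < N) :
    ∫ φ : ℝ, szegoKernel (lamC c) N (Complex.exp (Complex.I * φ)) w *
      Complex.exp (-(Complex.I * j * φ)) ∂(circMeasure b c) =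
      Complex.I * (b * (c ^ 2 - 1)) / lamC c * w ^ (N - 1 - j) := by
  induction N generalizing j with
  | zero => omega
  | succ N ih =>
    have hB := continuous_szegoKernel (lamC c) N w
    have hM := continuous_szegoPoly N (1 + lamC c)
    have hM' := continuous_szegoPoly N (lamC c)
    have split : ∀ j : ℕ, ∫ φ : ℝ, szegoKernel (lamC c) (N + 1) (Complex.exp (Complex.I * φ)) w *
        Complex.exp (-(Complex.I * j * φ)) ∂(circMeasure b c) =
        w * (∫ φ : ℝ, szegoKernel (lamC c) N (Complex.exp (Complex.I * φ)) w *
        Complex.exp (-(Complex.I * j * φ)) ∂(circMeasure b c)) + szegoPoly N (lamC c) w *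
        ∫ φ : ℝ, szegoPoly N (1 + lamC c) (Complex.exp (Complex.I * φ)) *
        Complex.exp (-(Complex.I * j * φ)) ∂(circMeasure b c) := by
      intro j
      rw [← integral_const_mul, ← integral_const_mul, ← integral_add
        (Continuous.integrable_circMeasure hb hc (by fun_prop))
        (Continuous.integrable_circMeasure hb hc (by fun_prop))]
      refine integral_congr_ae (Eventually.of_forall fun φ => ?_)
      simp only [szegoKernel]
      ring
    rcases Nat.lt_succ_iff_lt_or_eq.1 hj with hj | rfl
    · rw [split, ih hj, integral_szegoPoly_one_add hb hc hc1 hj,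
        show N + 1 - 1 - j = N - 1 - j + 1 by omega]
      ring
    · rw [split]
      rcases j with _ | j
      · have := integral_szegoPoly hb hc hc1 0 (1 + lamC c) 0
        simp only [szegoKernel, zero_mul, integral_zero, mul_zero, zero_add]
        push_cast at this
        rw [Nat.cast_zero, this]
        simp [szegoPoly, div_eq_mul_inv]
      · have h1 := ih (Nat.lt_succ_self j)
        have h2 := integral_szegoPoly_lamC hb hc hc1 (Nat.lt_succ_self j)
        set f := fun φ : ℝ => szegoKernel (lamC c) (j + 1) (Complex.exp (Complex.I * φ)) w with hf
        have h3 : ∀ φ : ℝ, f φ * Complex.exp (-(Complex.I * j * φ)) =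
            w * (f φ * Complex.exp (-(Complex.I * (j + 1) * φ))) +
            (szegoPoly (j + 1) (lamC c) w * (szegoPoly (j + 1) (1 + lamC c)
              (Complex.exp (Complex.I * φ)) * Complex.exp (-(Complex.I * (j + 1) * φ))) -
            szegoPoly (j + 1) (1 + lamC c) w * (szegoPoly (j + 1) (lamC c)
              (Complex.exp (Complex.I * φ)) * Complex.exp (-(Complex.I * (j + 1) * φ)))) := by
          intro φ
          have e : Complex.exp (-(Complex.I * j * φ)) =
              Complex.exp (-(Complex.I * (j + 1) * φ)) * Complex.exp (Complex.I * φ) := by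
            rw [← Complex.exp_add]; congr 1; ring
          rw [e]
          linear_combination Complex.exp (-(Complex.I * (j + 1) * φ)) *
            sub_mul_szegoKernel (lamC c) (j + 1) (Complex.exp (Complex.I * φ)) w
        have hf' : Continuous f := by simp only [hf]; fun_prop
        have h4 : ∫ φ : ℝ, f φ * Complex.exp (-(Complex.I * j * φ)) ∂(circMeasure b c) = _ :=
          integral_congr_ae (Eventually.of_forall h3)
        rw [integral_add (Continuous.integrable_circMeasure hb hc (by fun_prop))
          (Continuous.integrable_circMeasure hb hc (by fun_prop)),
          integral_sub (Continuous.integrable_circMeasure hb hc (by fun_prop))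
          (Continuous.integrable_circMeasure hb hc (by fun_prop)), integral_const_mul,
          integral_const_mul, integral_const_mul, h2, h1] at h4
        push_cast
        rw [← sub_eq_zero] at h4 ⊢
        simp only [mul_zero, sub_zero, Nat.add_sub_cancel, Nat.sub_self] at h4 ⊢
        rw [← neg_eq_zero, ← h4]
        ring

/-- Trigonometric polynomials of degree at most `d`. -/
def trigPoly (d : ℕ) : Submodule ℂ (ℝ → ℂ) :=
  Submodule.span ℂ ((fun (j : ℤ) (φ : ℝ) => Complex.exp (Complex.I * j * φ)) '' Icc (-(d : ℤ)) d)

theorem exp_mem_trigPoly {d : ℕ} {j : ℤ} (h1 : -(d : ℤ) ≤ j) (h2 : j ≤ d) :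
    (fun φ : ℝ => Complex.exp (Complex.I * j * φ)) ∈ trigPoly d :=
  Submodule.subset_span ⟨j, ⟨h1, h2⟩, rfl⟩

theorem trigPoly_mono {d e : ℕ} (h : d ≤ e) : trigPoly d ≤ trigPoly e :=
  Submodule.span_mono (image_mono (Icc_subset_Icc (by omega) (by omega)))

theorem mul_mem_trigPoly {d e : ℕ} {f g : ℝ → ℂ} (hf : f ∈ trigPoly d) (hg : g ∈ trigPoly e) :
    f * g ∈ trigPoly (d + e) := by
  have := Submodule.mul_mem_mul hf hg
  rw [trigPoly, trigPoly, Submodule.span_mul_span] at this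
  refine Submodule.span_le.2 ?_ this
  rintro _ ⟨_, ⟨j, hj, rfl⟩, _, ⟨k, hk, rfl⟩, rfl⟩
  have h : (fun (j : ℤ) (φ : ℝ) => Complex.exp (Complex.I * j * φ)) j *
      (fun (j : ℤ) (φ : ℝ) => Complex.exp (Complex.I * j * φ)) k =
      fun φ : ℝ => Complex.exp (Complex.I * (j + k : ℤ) * φ) := by
    ext φ
    simp only [Pi.mul_apply, ← Complex.exp_add]
    congr 1; push_cast; ring
  simp only [SetLike.mem_coe]
  rw [h]
  exact exp_mem_trigPoly (by push_cast; linarith [hj.1, hk.1]) (by push_cast; linarith [hj.2, hk.2])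

theorem one_mem_trigPoly (d : ℕ) : (1 : ℝ → ℂ) ∈ trigPoly d := by
  have := exp_mem_trigPoly (d := d) (j := 0) (by simp) (by simp)
  convert this using 1
  ext; simp

theorem pow_mem_trigPoly {d : ℕ} {f : ℝ → ℂ} (hf : f ∈ trigPoly d) (k : ℕ) :
    f ^ k ∈ trigPoly (k * d) := by
  induction k with
  | zero => simpa using one_mem_trigPoly 0
  | succ k ih =>
    rw [pow_succ, Nat.succ_mul]
    exact mul_mem_trigPoly ih hf

theorem continuous_of_mem_trigPoly {d : ℕ} {f : ℝ → ℂ} (hf : f ∈ trigPoly d) : Continuous f := by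
  induction hf using Submodule.span_induction with
  | mem x h => obtain ⟨j, _, rfl⟩ := h; fun_prop
  | zero => exact continuous_const
  | add x y _ _ hx hy => exact hx.add hy
  | smul a x _ hx => exact continuous_const.mul hx

theorem conj_mem_trigPoly {d : ℕ} {f : ℝ → ℂ} (hf : f ∈ trigPoly d) :
    (fun φ => starRingEnd ℂ (f φ)) ∈ trigPoly d := by
  induction hf using Submodule.span_induction with
  | mem x h =>
    obtain ⟨j, hj, rfl⟩ := h
    have := exp_mem_trigPoly (d := d) (j := -j) (by linarith [hj.2]) (by linarith [hj.1])
    convert this using 2 with φ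
    rw [← Complex.exp_conj]
    simp
  | zero => convert (trigPoly d).zero_mem using 1; ext; simp
  | add x y _ _ hx hy => convert add_mem hx hy using 1; ext φ; simp
  | smul a x _ hx => convert (trigPoly d).smul_mem (starRingEnd ℂ a) hx using 1; ext φ; simp

theorem cos_mem_trigPoly : (fun φ : ℝ => ((Real.cos φ : ℝ) : ℂ)) ∈ trigPoly 1 := by
  have h := (trigPoly 1).smul_mem (1 / 2) (add_mem (exp_mem_trigPoly (d := 1) (j := 1) (by simp) (by simp))
    (exp_mem_trigPoly (d := 1) (j := -1) (by simp) (by simp)))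
  convert h using 1
  ext φ
  simp [Complex.cos]
  ring_nf

theorem sin_mem_trigPoly : (fun φ : ℝ => ((Real.sin φ : ℝ) : ℂ)) ∈ trigPoly 1 := by
  have h := (trigPoly 1).smul_mem (Complex.I / 2) (sub_mem (exp_mem_trigPoly (d := 1) (j := -1) (by simp) (by simp))
    (exp_mem_trigPoly (d := 1) (j := 1) (by simp) (by simp)))
  convert h using 1
  ext φ
  simp [Complex.sin]
  ring_nf

theorem eval_sin_mem_trigPoly {n : ℕ} {P : Polynomial ℝ} (hP : P.natDegree ≤ n) :
    (fun φ : ℝ => ((P.eval (Real.sin φ) : ℝ) : ℂ)) ∈ trigPoly n := by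
  have h : (fun φ : ℝ => ((P.eval (Real.sin φ) : ℝ) : ℂ)) =
      ∑ k ∈ Finset.range (n + 1), ((P.coeff k : ℝ) : ℂ) • (fun φ : ℝ => ((Real.sin φ : ℝ) : ℂ)) ^ k := by
    ext φ
    rw [Polynomial.eval_eq_sum_range' (Nat.lt_succ_of_le hP)]
    simp
  rw [h]
  refine sum_mem fun k hk => (trigPoly n).smul_mem _ ?_
  exact trigPoly_mono (by simp at hk; omega) (pow_mem_trigPoly sin_mem_trigPoly k)

theorem exists_polynomial_symm {d : ℕ} {f : ℝ → ℂ} (hf : f ∈ trigPoly d) :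
    ∃ P : Polynomial ℝ, P.natDegree ≤ d ∧
      ∀ φ, P.eval (Real.sin φ) = (f φ + f (Real.pi - φ)).re := by
  have key : ∃ P : Polynomial ℂ, P.natDegree ≤ d ∧
      ∀ φ : ℝ, P.eval (Complex.sin φ) = f φ + f (Real.pi - φ) := by
    induction hf using Submodule.span_induction with
    | mem x h =>
      obtain ⟨j, hj, rfl⟩ := h
      refine ⟨Polynomial.C (2 * Complex.exp (Complex.I * j * (Real.pi / 2))) *
        Polynomial.Chebyshev.T ℂ j, ?_, fun φ => ?_⟩
      · refine (Polynomial.natDegree_C_mul_le _ _).trans ?_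
        rw [Polynomial.Chebyshev.natDegree_T]
        have := hj.1
        have := hj.2
        omega
      · rw [Polynomial.eval_mul, Polynomial.eval_C, ← Complex.cos_pi_div_two_sub,
          Polynomial.Chebyshev.T_complex_cos, Complex.cos]
        have : ∀ x : ℂ, 2 * Complex.exp (Complex.I * j * (Real.pi / 2)) * (x / 2) =
          Complex.exp (Complex.I * j * (Real.pi / 2)) * x := fun x => by ring
        rw [this, mul_add, ← Complex.exp_add, ← Complex.exp_add, add_comm]
        congr 2 <;> push_cast <;> ring
    | zero => exact ⟨0, by simp, by simp⟩
    | add x y _ _ hx hy =>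
      obtain ⟨P, hP, hP'⟩ := hx
      obtain ⟨Q, hQ, hQ'⟩ := hy
      refine ⟨P + Q, Polynomial.natDegree_add_le_of_degree_le hP hQ, fun φ => ?_⟩
      simp only [Polynomial.eval_add, hP', hQ', Pi.add_apply]; ring
    | smul a x _ hx =>
      obtain ⟨P, hP, hP'⟩ := hx
      refine ⟨Polynomial.C a * P, (Polynomial.natDegree_C_mul_le _ _).trans hP, fun φ => ?_⟩
      simp only [Polynomial.eval_mul, Polynomial.eval_C, hP', Pi.smul_apply, smul_eq_mul]; ring
  obtain ⟨P, hP, hP'⟩ := key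
  refine ⟨∑ k ∈ Finset.range (d + 1), Polynomial.monomial k (P.coeff k).re, ?_, fun φ => ?_⟩
  · refine Polynomial.natDegree_sum_le_of_forall_le _ _ fun k hk => ?_
    exact (Polynomial.natDegree_monomial_le _).trans (by simp at hk; omega)
  · rw [← hP', Polynomial.eval_eq_sum_range' (Nat.lt_succ_of_le hP), Polynomial.eval_finsetSum,
      Complex.re_sum]
    refine Finset.sum_congr rfl fun k _ => ?_
    rw [Polynomial.eval_monomial, ← Complex.ofReal_sin, ← Complex.ofReal_pow, Complex.re_mul_ofReal]

/-- The reproducing kernel of `trigPoly d` in `L²(circMeasure b c)`. -/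
noncomputable def trigKernel (b c : ℝ) (d : ℕ) (ψ φ : ℝ) : ℂ :=
  lamC c / (Complex.I * (b * (c ^ 2 - 1))) * Complex.exp (-(Complex.I * d * (φ + ψ))) *
    szegoKernel (lamC c) (2 * d + 1) (Complex.exp (Complex.I * φ)) (Complex.exp (Complex.I * ψ))

theorem exp_mul_one_sub_exp_pow_mem {d k : ℕ} {j : ℤ} (h1 : -(d : ℤ) ≤ j) (h2 : j + k ≤ d) :
    (fun φ : ℝ => Complex.exp (Complex.I * j * φ) * (1 - Complex.exp (Complex.I * φ)) ^ k) ∈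
      trigPoly d := by
  induction k generalizing j with
  | zero => simpa using exp_mem_trigPoly h1 (by simpa using h2)
  | succ k ih =>
    convert sub_mem (ih (j := j) h1 (by push_cast at h2; linarith))
      (ih (j := j + 1) (by linarith) (by push_cast at h2; linarith)) using 1
    ext φ
    simp only [Pi.sub_apply]
    have : Complex.exp (Complex.I * ((j + 1 : ℤ) : ℂ) * φ) =
          Complex.exp (Complex.I * j * φ) * Complex.exp (Complex.I * φ) := by
        rw [← Complex.exp_add]; congr 1; push_cast; ring
    rw [this]; ring

theorem exp_mul_szegoKernel_mem (l w : ℂ) {d N : ℕ} (hN : N ≤ 2 * d + 1) :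
    (fun φ : ℝ => Complex.exp (Complex.I * (-(d : ℤ) : ℤ) * φ) *
      szegoKernel l N (Complex.exp (Complex.I * φ)) w) ∈ trigPoly d := by
  induction N with
  | zero => convert (trigPoly d).zero_mem using 1; ext; simp [szegoKernel]
  | succ N ih =>
    have h : (fun φ : ℝ => Complex.exp (Complex.I * (-(d : ℤ) : ℤ) * φ) *
      szegoKernel l (N + 1) (Complex.exp (Complex.I * φ)) w) =
      w • (fun φ : ℝ => Complex.exp (Complex.I * (-(d : ℤ) : ℤ) * φ) *
      szegoKernel l N (Complex.exp (Complex.I * φ)) w) +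
      szegoPoly N l w • ∑ k ∈ Finset.range (N + 1), ((-1 : ℂ) ^ k * (N.choose k) *
        (ascPochhammer ℂ k).eval (1 + l) / (k.factorial : ℂ)) •
        (fun φ : ℝ => Complex.exp (Complex.I * (-(d : ℤ) : ℤ) * φ) *
          (1 - Complex.exp (Complex.I * φ)) ^ k) := by
      ext φ
      simp only [szegoKernel, Pi.add_apply, Pi.smul_apply, Finset.sum_apply, smul_eq_mul]
      nth_rewrite 2 [szegoPoly]
      rw [mul_add, Finset.mul_sum, Finset.mul_sum, Finset.mul_sum]
      congr 1
      · ring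
      · exact Finset.sum_congr rfl fun k _ => by ring
    rw [h]
    refine add_mem ((trigPoly d).smul_mem _ (ih (by omega))) ((trigPoly d).smul_mem _ ?_)
    refine sum_mem fun k hk => (trigPoly d).smul_mem _ ?_
    simp at hk
    exact exp_mul_one_sub_exp_pow_mem le_rfl (by omega)

theorem trigKernel_mem (b c : ℝ) (d : ℕ) (ψ : ℝ) : trigKernel b c d ψ ∈ trigPoly d := by
  have h := (trigPoly d).smul_mem (lamC c / (Complex.I * (b * (c ^ 2 - 1))) *
    Complex.exp (-(Complex.I * d * ψ))) (exp_mul_szegoKernel_mem (lamC c)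
      (Complex.exp (Complex.I * ψ)) (le_refl (2 * d + 1)))
  convert h using 1
  ext φ
  simp only [trigKernel, Pi.smul_apply, smul_eq_mul]
  rw [show -(Complex.I * d * (φ + ψ)) = -(Complex.I * d * ψ) + Complex.I * (-(d : ℤ) : ℤ) * φ by
    push_cast; ring, Complex.exp_add]
  ring

theorem integral_trigKernel_mul {b c : ℝ} (hb : 0 < b) (hc : 0 < c) (hc1 : c ≠ 1) {d : ℕ}
    (ψ : ℝ) {f : ℝ → ℂ} (hf : f ∈ trigPoly d) :
    ∫ φ, trigKernel b c d ψ φ * f φ ∂(circMeasure b c) = f ψ := by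
  have hk := continuous_of_mem_trigPoly (trigKernel_mem b c d ψ)
  induction hf using Submodule.span_induction with
  | mem x h =>
    obtain ⟨j, hj, rfl⟩ := h
    obtain ⟨m, hm⟩ : ∃ m : ℕ, (m : ℤ) = d - j := ⟨(d - j).toNat, by
      rw [Int.toNat_of_nonneg]; linarith [hj.2]⟩
    have hm' : m < 2 * d + 1 := by have := hj.1; omega
    have h := integral_szegoKernel hb hc hc1 (Complex.exp (Complex.I * ψ)) hm'
    have e : ∀ φ : ℝ, trigKernel b c d ψ φ * Complex.exp (Complex.I * j * φ) =
        lamC c / (Complex.I * (b * (c ^ 2 - 1))) * Complex.exp (-(Complex.I * d * ψ)) *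
        (szegoKernel (lamC c) (2 * d + 1) (Complex.exp (Complex.I * φ)) (Complex.exp (Complex.I * ψ))
        * Complex.exp (-(Complex.I * m * φ))) := by
      intro φ
      have : Complex.exp (-(Complex.I * d * (φ + ψ))) * Complex.exp (Complex.I * j * φ) =
          Complex.exp (-(Complex.I * d * ψ)) * Complex.exp (-(Complex.I * m * φ)) := by
        rw [← Complex.exp_add, ← Complex.exp_add]
        congr 1
        have : (m : ℂ) = d - j := by exact_mod_cast congrArg (Int.cast : ℤ → ℂ) hm
        rw [this]; ring
      rw [trigKernel]
      linear_combination lamC c / (Complex.I * (b * (c ^ 2 - 1))) * szegoKernel (lamC c) (2 * d + 1)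
        (Complex.exp (Complex.I * φ)) (Complex.exp (Complex.I * ψ)) * this
    simp only [e]
    rw [integral_const_mul, h, ← Complex.exp_nat_mul]
    have hl : lamC c ≠ 0 := fun h => lamC_im hc hc1 (by simp [h])
    have hb' : (b : ℂ) ≠ 0 := by exact_mod_cast hb.ne'
    have hc' : (c : ℂ) ^ 2 - 1 ≠ 0 := by
      have : c ^ 2 - 1 ≠ 0 := fun h => hc1 (by nlinarith)
      exact_mod_cast this
    have hI := Complex.I_ne_zero
    have e2 : Complex.exp (-(Complex.I * d * ψ)) *
        Complex.exp (((2 * d + 1 - 1 - m : ℕ) : ℂ) * (Complex.I * ψ)) =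
        Complex.exp (Complex.I * j * ψ) := by
      rw [← Complex.exp_add]
      congr 1
      have : ((2 * d + 1 - 1 - m : ℕ) : ℤ) = d + j := by omega
      have : ((2 * d + 1 - 1 - m : ℕ) : ℂ) = d + j := by
        exact_mod_cast congrArg (Int.cast : ℤ → ℂ) this
      rw [this]; ring
    rw [← e2]
    field_simp
  | zero => simp
  | add x y hx' hy' hx hy =>
    have hx' := continuous_of_mem_trigPoly hx'
    have hy' := continuous_of_mem_trigPoly hy'
    simp only [Pi.add_apply, mul_add]
    rw [integral_add (Continuous.integrable_circMeasure hb hc (by fun_prop))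
      (Continuous.integrable_circMeasure hb hc (by fun_prop)), hx, hy]
  | smul a x _ hx =>
    simp only [Pi.smul_apply, smul_eq_mul, mul_left_comm _ a]
    rw [integral_const_mul, hx]

theorem integral_norm_sub_trigKernel_sq {b c : ℝ} (hb : 0 < b) (hc : 0 < c) (hc1 : c ≠ 1) {d : ℕ}
    (ψ : ℝ) {f : ℝ → ℂ} (hf : f ∈ trigPoly d) (t : ℂ) :
    ∫ φ, ‖f φ - t * starRingEnd ℂ (trigKernel b c d ψ φ)‖ ^ 2 ∂(circMeasure b c) =
      ∫ φ, ‖f φ‖ ^ 2 ∂(circMeasure b c) - 2 * (starRingEnd ℂ t * f ψ).re +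
        ‖t‖ ^ 2 * (trigKernel b c d ψ ψ).re := by
  have hkm := trigKernel_mem b c d ψ
  have hk := continuous_of_mem_trigPoly hkm
  have hfc := continuous_of_mem_trigPoly hf
  have h1 := integral_trigKernel_mul hb hc hc1 ψ hf
  have h2 := integral_trigKernel_mul hb hc hc1 ψ (conj_mem_trigPoly hkm)
  have hkc : Continuous fun φ => starRingEnd ℂ (trigKernel b c d ψ φ) :=
    Complex.continuous_conj.comp hk
  have e : ∀ φ, ‖f φ - t * starRingEnd ℂ (trigKernel b c d ψ φ)‖ ^ 2 =
      ‖f φ‖ ^ 2 - 2 * (starRingEnd ℂ t * (trigKernel b c d ψ φ * f φ)).re +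
        ‖t‖ ^ 2 * (trigKernel b c d ψ φ * starRingEnd ℂ (trigKernel b c d ψ φ)).re := by
    intro φ
    rw [Complex.mul_conj, Complex.ofReal_re, Complex.sq_norm, Complex.sq_norm, Complex.sq_norm,
      Complex.normSq_sub, Complex.normSq_mul, Complex.normSq_conj]
    have : f φ * starRingEnd ℂ (t * starRingEnd ℂ (trigKernel b c d ψ φ)) =
        starRingEnd ℂ t * (trigKernel b c d ψ φ * f φ) := by
      rw [map_mul, Complex.conj_conj]; ring
    rw [this]; ring
  simp only [e]
  have i1 : Integrable (fun φ => starRingEnd ℂ t * (trigKernel b c d ψ φ * f φ))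
    (circMeasure b c) := Continuous.integrable_circMeasure hb hc (by fun_prop)
  have i2 : Integrable (fun φ => trigKernel b c d ψ φ * starRingEnd ℂ (trigKernel b c d ψ φ))
    (circMeasure b c) := Continuous.integrable_circMeasure hb hc (by fun_prop)
  have i3 : Integrable (fun φ => ‖f φ‖ ^ 2) (circMeasure b c) :=
    Continuous.integrable_circMeasure hb hc (by fun_prop)
  have j1 : Integrable (fun φ => 2 * (starRingEnd ℂ t * (trigKernel b c d ψ φ * f φ)).re)
    (circMeasure b c) := i1.re.const_mul 2
  have j2 : Integrable (fun φ => ‖t‖ ^ 2 *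
    (trigKernel b c d ψ φ * starRingEnd ℂ (trigKernel b c d ψ φ)).re) (circMeasure b c) :=
    i2.re.const_mul _
  have j3 : Integrable (fun φ => ‖f φ‖ ^ 2 -
    2 * (starRingEnd ℂ t * (trigKernel b c d ψ φ * f φ)).re) (circMeasure b c) := i3.sub j1
  rw [integral_add j3 j2, integral_sub i3 j1, integral_const_mul, integral_const_mul]
  have r1 := integral_re i1
  have r2 := integral_re i2
  simp only [RCLike.re_to_complex] at r1 r2
  rw [r1, r2, integral_const_mul, h1, h2, Complex.conj_re]

theorem norm_sq_le_trigKernel_mul {b c : ℝ} (hb : 0 < b) (hc : 0 < c) (hc1 : c ≠ 1) {d : ℕ}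
    (ψ : ℝ) {f : ℝ → ℂ} (hf : f ∈ trigPoly d) :
    ‖f ψ‖ ^ 2 ≤ (trigKernel b c d ψ ψ).re * ∫ φ, ‖f φ‖ ^ 2 ∂(circMeasure b c) := by
  have key : ∀ s : ℝ, 0 ≤ ‖f ψ‖ ^ 2 * (trigKernel b c d ψ ψ).re * (s * s) +
      -(2 * ‖f ψ‖ ^ 2) * s + ∫ φ, ‖f φ‖ ^ 2 ∂(circMeasure b c) := by
    intro s
    have h := integral_norm_sub_trigKernel_sq hb hc hc1 ψ hf (s * f ψ)
    have h0 : 0 ≤ ∫ φ, ‖f φ - (s * f ψ) * starRingEnd ℂ (trigKernel b c d ψ φ)‖ ^ 2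
      ∂(circMeasure b c) := integral_nonneg fun φ => by positivity
    rw [h] at h0
    have : starRingEnd ℂ (s * f ψ) * f ψ = ((s * ‖f ψ‖ ^ 2 : ℝ) : ℂ) := by
      rw [map_mul, mul_assoc, Complex.conj_mul']; simp
    rw [this, Complex.ofReal_re, norm_mul, mul_pow, Complex.norm_real, Real.norm_eq_abs, sq_abs] at h0
    linarith
  have h := discrim_le_zero key
  rw [discrim] at h
  rcases (sq_nonneg ‖f ψ‖).eq_or_lt with h0 | h0
  · rw [← h0]
    refine mul_nonneg ?_ (integral_nonneg fun φ => by positivity)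
    have h := integral_norm_sub_trigKernel_sq hb hc hc1 ψ (trigPoly d).zero_mem 1
    have h0 : 0 ≤ ∫ φ, ‖(0 : ℝ → ℂ) φ - 1 * starRingEnd ℂ (trigKernel b c d ψ φ)‖ ^ 2
      ∂(circMeasure b c) := integral_nonneg fun φ => by positivity
    rw [h] at h0
    simpa using h0
  · nlinarith

theorem trigKernel_self_nonneg {b c : ℝ} (hb : 0 < b) (hc : 0 < c) (hc1 : c ≠ 1) (d : ℕ)
    (ψ : ℝ) : 0 ≤ (trigKernel b c d ψ ψ).re := by
  have h := integral_norm_sub_trigKernel_sq hb hc hc1 ψ (trigPoly d).zero_mem 1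
  have h0 : 0 ≤ ∫ φ, ‖(0 : ℝ → ℂ) φ - 1 * starRingEnd ℂ (trigKernel b c d ψ φ)‖ ^ 2
    ∂(circMeasure b c) := integral_nonneg fun φ => by positivity
  rw [h] at h0
  simpa using h0

theorem integral_norm_trigKernel_sq {b c : ℝ} (hb : 0 < b) (hc : 0 < c) (hc1 : c ≠ 1) (d : ℕ)
    (ψ : ℝ) : ∫ φ, ‖trigKernel b c d ψ φ‖ ^ 2 ∂(circMeasure b c) = (trigKernel b c d ψ ψ).re := by
  simpa using integral_norm_sub_trigKernel_sq hb hc hc1 ψ (trigPoly d).zero_mem 1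

/-- A real trigonometric polynomial is close to the reproducing kernel as soon as its norm is
nearly minimal for its value at the base point. -/
theorem norm_sub_trigKernel_sq_le {b c : ℝ} (hb : 0 < b) (hc : 0 < c) (hc1 : c ≠ 1) {d : ℕ}
    (ψ θ : ℝ) {f : ℝ → ℝ} (hf : (fun φ => (f φ : ℂ)) ∈ trigPoly d) :
    ‖(f θ : ℂ) - trigKernel b c d ψ θ‖ ^ 2 ≤ (trigKernel b c d θ θ).re *
      (∫ φ, f φ ^ 2 ∂(circMeasure b c) - 2 * f ψ + (trigKernel b c d ψ ψ).re) := by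
  have hD := sub_mem hf (conj_mem_trigPoly (trigKernel_mem b c d ψ))
  have h1 := norm_sq_le_trigKernel_mul hb hc hc1 θ hD
  have h2 := integral_norm_sub_trigKernel_sq hb hc hc1 ψ hf 1
  simp only [one_mul, map_one, norm_one, one_pow, Complex.ofReal_re, Complex.norm_real,
    Real.norm_eq_abs, sq_abs] at h2
  simp only [Pi.sub_apply] at h1
  rw [h2] at h1
  rw [← Complex.norm_conj, map_sub, Complex.conj_ofReal]
  exact h1

/-- A nonnegative trigonometric polynomial peaking at the origin and vanishing at `±π/2`. -/
noncomputable def needle (L m : ℕ) (φ : ℝ) : ℝ :=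
  Real.cos φ ^ (2 * L) * ((1 + Real.cos φ) / 2) ^ m

theorem continuous_needle (L m : ℕ) : Continuous (needle L m) := by
  unfold needle; fun_prop

theorem needle_nonneg (L m : ℕ) (φ : ℝ) : 0 ≤ needle L m φ := by
  have := Real.neg_one_le_cos φ
  have := (even_two_mul L).pow_nonneg (Real.cos φ)
  have : 0 ≤ (1 + Real.cos φ) / 2 := by linarith
  unfold needle
  positivity

theorem needle_le_one (L m : ℕ) (φ : ℝ) : needle L m φ ≤ 1 := by
  have h1 := Real.neg_one_le_cos φ
  have h2 := Real.cos_le_one φ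
  have h3 : 0 ≤ (1 + Real.cos φ) / 2 := by linarith
  refine mul_le_one₀ ?_ (by positivity) (pow_le_one₀ h3 (by linarith))
  rw [pow_mul]
  exact pow_le_one₀ (sq_nonneg _) (Real.cos_sq_le_one φ)

theorem needle_mem_trigPoly (L m : ℕ) :
    (fun φ => (needle L m φ : ℂ)) ∈ trigPoly (2 * L + m) := by
  have h1 := pow_mem_trigPoly cos_mem_trigPoly (2 * L)
  have h2 := pow_mem_trigPoly ((trigPoly 1).smul_mem (1 / 2)
    (add_mem (one_mem_trigPoly 1) cos_mem_trigPoly)) m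
  rw [mul_one] at h1 h2
  convert mul_mem_trigPoly h1 h2 using 1
  ext φ
  simp [needle]
  left
  congr 1; ring

theorem needle_pi_sub_sq_le (L m : ℕ) {φ : ℝ} (hφ : φ ∈ Ioo (-(Real.pi / 2)) (Real.pi / 2)) :
    needle L m (Real.pi - φ) ^ 2 ≤ Real.cos φ ^ (4 * L) * (1 / 4) ^ m := by
  have h := Real.cos_pos_of_mem_Ioo hφ
  have h2 := Real.cos_le_one φ
  have h0 : 0 ≤ (1 + -Real.cos φ) / 2 := by linarith
  rw [needle, Real.cos_pi_sub, mul_pow, ← pow_mul, ← pow_mul, mul_comm m 2, pow_mul _ 2 m,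
    Even.neg_pow ⟨2 * L, by ring⟩, show 2 * L * 2 = 4 * L by ring]
  gcongr
  nlinarith

theorem eventually_needle_mul_le {r : ℝ → ℝ} (hr : ContinuousAt r 0) (hr0 : r 0 = 1) {L : ℕ}
    {C C' : ℝ} (hC' : 0 ≤ C')
    (hC : ∀ φ ∈ Ioo (-(Real.pi / 2)) (Real.pi / 2), 0 ≤ r φ ∧ Real.cos φ ^ (4 * L) * r φ ≤ C)
    {ε : ℝ} (hε : 0 < ε) :
    ∀ᶠ m in atTop, ∀ φ ∈ Ioo (-(Real.pi / 2)) (Real.pi / 2),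
      (needle L m φ ^ 2 + C' * needle L m (Real.pi - φ) ^ 2) * r φ ≤ 1 + ε := by
  obtain ⟨η, hη, hηr⟩ := Metric.continuousAt_iff.1 hr (ε / 2) (by positivity)
  set η' := min η (Real.pi / 2) with hη'
  have hpi := Real.pi_pos
  have hη'0 : 0 < η' := lt_min hη (by positivity)
  have hq : Real.cos η' < 1 := by
    rw [← Real.cos_zero]
    exact Real.cos_lt_cos_of_nonneg_of_le_pi le_rfl ((min_le_right _ _).trans (by linarith)) hη'0
  set q := ((1 + Real.cos η') / 2) ^ 2 with hqd
  have hq0 : 0 ≤ (1 + Real.cos η') / 2 := by linarith [Real.neg_one_le_cos η']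
  have hq1 : q < 1 := by rw [hqd]; exact pow_lt_one₀ hq0 (by linarith) two_ne_zero
  have t1 : Tendsto (fun m : ℕ => C * q ^ m) atTop (nhds (C * 0)) :=
    (tendsto_pow_atTop_nhds_zero_of_lt_one (by positivity) hq1).const_mul C
  have t2 : Tendsto (fun m : ℕ => C' * C * (1 / 4 : ℝ) ^ m) atTop (nhds (C' * C * 0)) :=
    (tendsto_pow_atTop_nhds_zero_of_lt_one (by norm_num) (by norm_num)).const_mul _
  rw [mul_zero] at t1 t2
  filter_upwards [t1.eventually_le_const zero_lt_one,
    t2.eventually_le_const (half_pos hε)] with m h1 h2 φ hφ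
  obtain ⟨hr1, hr2⟩ := hC φ hφ
  have hcos := Real.cos_pos_of_mem_Ioo hφ
  have e1 : needle L m φ ^ 2 * r φ ≤ 1 + ε / 2 := by
    rcases lt_or_ge |φ| η' with hlt | hge
    · have := hηr (x := φ) (by simpa using hlt.trans_le (min_le_left _ _))
      rw [hr0, Real.dist_eq] at this
      have h3 := (abs_lt.1 this).2
      have h4 : needle L m φ ^ 2 ≤ 1 := pow_le_one₀ (needle_nonneg _ _ _) (needle_le_one _ _ _)
      nlinarith
    · have h5 : Real.cos φ ≤ Real.cos η' := by
        rw [← Real.cos_abs φ]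
        exact Real.cos_le_cos_of_nonneg_of_le_pi hη'0.le
          ((abs_lt.2 ⟨hφ.1, hφ.2⟩).le.trans (by linarith)) hge
      have h6 : needle L m φ ^ 2 ≤ Real.cos φ ^ (4 * L) * q ^ m := by
        rw [needle, mul_pow, ← pow_mul, ← pow_mul, show 2 * L * 2 = 4 * L by ring, mul_comm m 2,
          pow_mul _ 2 m, hqd]
        gcongr
      calc needle L m φ ^ 2 * r φ ≤ Real.cos φ ^ (4 * L) * q ^ m * r φ := by gcongr
        _ = (Real.cos φ ^ (4 * L) * r φ) * q ^ m := by ring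
        _ ≤ C * q ^ m := by gcongr
        _ ≤ _ := by linarith
  have e2 : C' * needle L m (Real.pi - φ) ^ 2 * r φ ≤ ε / 2 := by
    calc C' * needle L m (Real.pi - φ) ^ 2 * r φ
        ≤ C' * (Real.cos φ ^ (4 * L) * (1 / 4) ^ m) * r φ := by
          gcongr; exact needle_pi_sub_sq_le L m hφ
      _ = C' * (Real.cos φ ^ (4 * L) * r φ) * (1 / 4) ^ m := by ring
      _ ≤ C' * C * (1 / 4) ^ m := by gcongr
      _ ≤ _ := h2
  linarith

/-- The ratio of the transported weight `w (sin φ) cos φ` to the model weight. -/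
noncomputable def weightRatio (h : ℝ → ℝ) (α β c φ : ℝ) : ℝ :=
  h (Real.sin φ) / h 0 * (1 - Real.sin φ) ^ α * (1 + Real.sin φ) ^ β * Real.cos φ *
    Real.exp (Real.log c / Real.pi * φ)

theorem rpow_mul_pow_le {u a : ℝ} (hu : 0 < u) (hu2 : u ≤ 2) {M : ℕ} (ha : |a| ≤ M) :
    u ^ a * u ^ M ≤ 2 ^ (a + M) := by
  rw [← Real.rpow_natCast u M, ← Real.rpow_add hu]
  exact Real.rpow_le_rpow hu.le hu2 (by linarith [(abs_le.1 ha).1])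

theorem sin_mem_Ioo {φ : ℝ} (hφ : φ ∈ Ioo (-(Real.pi / 2)) (Real.pi / 2)) :
    Real.sin φ ∈ Ioo (-1 : ℝ) 1 := by
  have h := Real.cos_pos_of_mem_Ioo hφ
  have := Real.sin_sq_add_cos_sq φ
  constructor <;> nlinarith

theorem continuousAt_weightRatio {h : ℝ → ℝ} (hh : ContinuousOn h (Icc (-1) 1)) (α β c : ℝ) :
    ContinuousAt (weightRatio h α β c) 0 := by
  have h0 : ContinuousAt h (Real.sin 0) := by
    rw [Real.sin_zero]
    exact hh.continuousAt (Icc_mem_nhds (by norm_num) (by norm_num))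
  have h1 : ContinuousAt (fun φ => h (Real.sin φ)) 0 :=
    ContinuousAt.comp h0 Real.continuous_sin.continuousAt
  have h2 : ContinuousAt (fun φ => (1 - Real.sin φ) ^ α) 0 :=
    ContinuousAt.rpow_const (by fun_prop) (by simp)
  have h3 : ContinuousAt (fun φ => (1 + Real.sin φ) ^ β) 0 :=
    ContinuousAt.rpow_const (by fun_prop) (by simp)
  unfold weightRatio
  fun_prop

theorem weightRatio_zero {h : ℝ → ℝ} (h0 : h 0 ≠ 0) (α β c : ℝ) : weightRatio h α β c 0 = 1 := by
  simp [weightRatio, h0]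

theorem weightRatio_pos {h : ℝ → ℝ} (h_pos : ∀ x ∈ Icc (-1 : ℝ) 1, 0 < h x) (α β c : ℝ) {φ : ℝ}
    (hφ : φ ∈ Ioo (-(Real.pi / 2)) (Real.pi / 2)) : 0 < weightRatio h α β c φ := by
  have h1 := sin_mem_Ioo hφ
  have := h_pos _ (Ioo_subset_Icc_self h1)
  have := h_pos 0 (by norm_num)
  have := Real.cos_pos_of_mem_Ioo hφ
  have := Real.rpow_pos_of_pos (show 0 < 1 - Real.sin φ by linarith [h1.2]) α
  have := Real.rpow_pos_of_pos (show 0 < 1 + Real.sin φ by linarith [h1.1]) β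
  unfold weightRatio
  positivity

theorem weightRatio_inv (h : ℝ → ℝ) (α β : ℝ) {c : ℝ} {φ : ℝ}
    (hφ : φ ∈ Ioo (-(Real.pi / 2)) (Real.pi / 2)) :
    (weightRatio h α β c φ)⁻¹ * Real.cos φ ^ 2 =
      weightRatio (fun x => (h x)⁻¹) (-α) (-β) c⁻¹ φ := by
  have h1 := sin_mem_Ioo hφ
  have := (Real.cos_pos_of_mem_Ioo hφ).ne'
  rw [weightRatio, weightRatio, Real.rpow_neg (by linarith [h1.2]), Real.rpow_neg (by linarith [h1.1]),
    Real.log_inv, neg_div, neg_mul, Real.exp_neg]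
  field_simp

theorem exists_cos_pow_mul_weightRatio_le {h : ℝ → ℝ} (hh : ContinuousOn h (Icc (-1) 1))
    (h_pos : ∀ x ∈ Icc (-1 : ℝ) 1, 0 < h x) (α β c : ℝ) {L : ℕ} (hα : |α| ≤ L)
    (hβ : |β| ≤ L) :
    ∃ C, ∀ φ ∈ Ioo (-(Real.pi / 2)) (Real.pi / 2),
      Real.cos φ ^ (2 * L) * weightRatio h α β c φ ≤ C := by
  obtain ⟨H, hH⟩ := isCompact_Icc.exists_bound_of_continuousOn hh
  obtain ⟨M, hM⟩ := (isCompact_Icc (a := -(Real.pi / 2)) (b := Real.pi / 2)).exists_bound_of_continuousOn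
    (f := fun φ => Real.exp (Real.log c / Real.pi * φ)) (by fun_prop)
  have h0 := h_pos 0 (by norm_num)
  refine ⟨H / h 0 * 2 ^ (α + L) * 2 ^ (β + L) * 1 * M, fun φ hφ => ?_⟩
  have h1 := sin_mem_Ioo hφ
  have p1 : 0 < 1 - Real.sin φ := by linarith [h1.2]
  have p2 : 0 < 1 + Real.sin φ := by linarith [h1.1]
  have hcos := Real.cos_pos_of_mem_Ioo hφ
  have e : Real.cos φ ^ (2 * L) = (1 - Real.sin φ) ^ L * (1 + Real.sin φ) ^ L := by
    rw [← mul_pow, pow_mul, Real.cos_sq']; congr 1; ring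
  have q0 := h_pos _ (Ioo_subset_Icc_self h1)
  have q1 := rpow_mul_pow_le p1 (by linarith [h1.1]) hα
  have q2 := rpow_mul_pow_le p2 (by linarith [h1.2]) hβ
  have q3 := hH _ (Ioo_subset_Icc_self h1)
  have q4 := hM _ (Ioo_subset_Icc_self hφ)
  rw [Real.norm_eq_abs, abs_of_pos q0] at q3
  rw [Real.norm_eq_abs, Real.abs_exp] at q4
  rw [e, weightRatio]
  calc _ = h (Real.sin φ) / h 0 * ((1 - Real.sin φ) ^ α * (1 - Real.sin φ) ^ L) *
        ((1 + Real.sin φ) ^ β * (1 + Real.sin φ) ^ L) * Real.cos φ *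
        Real.exp (Real.log c / Real.pi * φ) := by ring
    _ ≤ _ := by
      have hH0 : 0 ≤ H := q0.le.trans q3
      gcongr
      exact Real.cos_le_one φ

theorem exists_cos_pow_mul_weightRatio_inv_le {h : ℝ → ℝ} (hh : ContinuousOn h (Icc (-1) 1))
    (h_pos : ∀ x ∈ Icc (-1 : ℝ) 1, 0 < h x) (α β c : ℝ) :
    ∃ (L : ℕ) (C : ℝ), ∀ φ ∈ Ioo (-(Real.pi / 2)) (Real.pi / 2),
      Real.cos φ ^ (4 * L) * weightRatio h α β c φ ≤ C ∧
      Real.cos φ ^ (4 * L) * (weightRatio h α β c φ)⁻¹ ≤ C := by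
  obtain ⟨L, hL⟩ := exists_nat_ge (max 1 (max |α| |β|))
  have hL1 : 1 ≤ L := by exact_mod_cast (le_max_left _ _).trans hL
  have hα : |α| ≤ L := (le_max_left _ _).trans ((le_max_right _ _).trans hL)
  have hβ : |β| ≤ L := (le_max_right _ _).trans ((le_max_right _ _).trans hL)
  obtain ⟨C1, h1⟩ := exists_cos_pow_mul_weightRatio_le hh h_pos α β c hα hβ
  obtain ⟨C2, h2⟩ := exists_cos_pow_mul_weightRatio_le (h := fun x => (h x)⁻¹)
    (hh.inv₀ fun x hx => (h_pos x hx).ne') (fun x hx => inv_pos.2 (h_pos x hx)) (-α) (-β) c⁻¹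
    (by rwa [abs_neg]) (by rwa [abs_neg])
  refine ⟨L, max C1 C2, fun φ hφ => ⟨?_, ?_⟩⟩
  · refine le_trans ?_ ((h1 φ hφ).trans (le_max_left _ _))
    have := weightRatio_pos h_pos α β c hφ
    gcongr ?_ * _
    exact pow_le_pow_of_le_one (Real.cos_pos_of_mem_Ioo hφ).le (Real.cos_le_one φ) (by omega)
  · refine le_trans ?_ ((h2 φ hφ).trans (le_max_right _ _))
    rw [← weightRatio_inv h α β hφ, mul_left_comm, ← pow_add, mul_comm]
    have := weightRatio_pos h_pos α β c hφ
    gcongr _ * ?_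
    exact pow_le_pow_of_le_one (Real.cos_pos_of_mem_Ioo hφ).le (Real.cos_le_one φ) (by omega)

theorem sin_lt_zero_iff {φ : ℝ} (hφ : φ ∈ Ioo (-(Real.pi / 2)) (Real.pi / 2)) :
    Real.sin φ < 0 ↔ φ < 0 := by
  have := Real.pi_pos
  refine ⟨fun h => ?_, fun h => Real.sin_neg_of_neg_of_neg_pi_lt h (by linarith [hφ.1])⟩
  by_contra! h2
  exact absurd (Real.sin_nonneg_of_nonneg_of_le_pi h2 (by linarith [hφ.2])) (by linarith)

/-- The generalised Jacobi weight with a jump at the origin. -/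
noncomputable def jumpWeight (h : ℝ → ℝ) (α β c x : ℝ) : ℝ :=
  h x * (1 - x) ^ α * (1 + x) ^ β * (if x < 0 then 1 else c ^ 2)

theorem jumpWeight_sin_mul_cos {h : ℝ → ℝ} (h0 : h 0 ≠ 0) (α β c : ℝ) {φ : ℝ}
    (hφ : φ ∈ Ioo (-(Real.pi / 2)) (Real.pi / 2)) :
    jumpWeight h α β c (Real.sin φ) * Real.cos φ =
      weightRatio h α β c φ * circWeight (h 0) c φ := by
  simp only [jumpWeight, weightRatio, circWeight, sin_lt_zero_iff hφ, neg_mul, Real.exp_neg]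
  have := Real.exp_ne_zero (Real.log c / Real.pi * φ)
  field_simp

theorem image_sin_Ioo : Real.sin '' Ioo (-(Real.pi / 2)) (Real.pi / 2) = Ioo (-1) 1 := by
  refine Subset.antisymm (image_subset_iff.2 fun φ hφ => sin_mem_Ioo hφ) fun x hx => ?_
  exact ⟨Real.arcsin x, ⟨by simpa using Real.neg_pi_div_two_lt_arcsin.2 hx.1,
    Real.arcsin_lt_pi_div_two.2 hx.2⟩, Real.sin_arcsin hx.1.le hx.2.le⟩

theorem injOn_sin_Ioo : InjOn Real.sin (Ioo (-(Real.pi / 2)) (Real.pi / 2)) :=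
  Real.injOn_sin.mono Ioo_subset_Icc_self

theorem integral_sin_substitution (g : ℝ → ℝ) :
    ∫ x in Ioo (-1 : ℝ) 1, g x =
      ∫ φ in Ioo (-(Real.pi / 2)) (Real.pi / 2), Real.cos φ * g (Real.sin φ) := by
  rw [← image_sin_Ioo, integral_image_eq_integral_abs_deriv_smul measurableSet_Ioo
    (fun φ _ => (Real.hasDerivAt_sin φ).hasDerivWithinAt) injOn_sin_Ioo]
  refine setIntegral_congr_fun measurableSet_Ioo fun φ hφ => ?_
  simp [abs_of_pos (Real.cos_pos_of_mem_Ioo hφ)]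

theorem integrableOn_sin_substitution (g : ℝ → ℝ) :
    IntegrableOn g (Ioo (-1 : ℝ) 1) ↔
      IntegrableOn (fun φ => Real.cos φ * g (Real.sin φ)) (Ioo (-(Real.pi / 2)) (Real.pi / 2)) := by
  rw [← image_sin_Ioo, integrableOn_image_iff_integrableOn_abs_deriv_smul measurableSet_Ioo
    (fun φ _ => (Real.hasDerivAt_sin φ).hasDerivWithinAt) injOn_sin_Ioo]
  refine integrableOn_congr_fun (fun φ hφ => ?_) measurableSet_Ioo
  simp [abs_of_pos (Real.cos_pos_of_mem_Ioo hφ)]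

theorem integral_fold {F : ℝ → ℝ}
    (hF : IntegrableOn F (Icc (-(Real.pi / 2)) (3 * Real.pi / 2))) :
    IntegrableOn (fun φ => F φ + F (Real.pi - φ)) (Ioo (-(Real.pi / 2)) (Real.pi / 2)) ∧
    ∫ φ in Ioo (-(Real.pi / 2)) (3 * Real.pi / 2), F φ =
      ∫ φ in Ioo (-(Real.pi / 2)) (Real.pi / 2), (F φ + F (Real.pi - φ)) := by
  have hpi := Real.pi_pos
  have i1 : IntervalIntegrable F volume (-(Real.pi / 2)) (Real.pi / 2) :=
    (intervalIntegrable_iff_integrableOn_Icc_of_le (by linarith)).2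
      (hF.mono_set (Icc_subset_Icc le_rfl (by linarith)))
  have i2 : IntervalIntegrable F volume (Real.pi / 2) (3 * Real.pi / 2) :=
    (intervalIntegrable_iff_integrableOn_Icc_of_le (by linarith)).2
      (hF.mono_set (Icc_subset_Icc (by linarith) le_rfl))
  have i3 : IntervalIntegrable (fun φ => F (Real.pi - φ)) volume (-(Real.pi / 2)) (Real.pi / 2) := by
    have := i2.comp_sub_left Real.pi
    rw [show Real.pi - Real.pi / 2 = Real.pi / 2 by ring,
      show Real.pi - 3 * Real.pi / 2 = -(Real.pi / 2) by ring] at this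
    exact this.symm
  refine ⟨((intervalIntegrable_iff_integrableOn_Ioo_of_le (by linarith)).1 (i1.add i3)), ?_⟩
  rw [← integral_Ioc_eq_integral_Ioo, ← integral_Ioc_eq_integral_Ioo,
    ← intervalIntegral.integral_of_le (by linarith), ← intervalIntegral.integral_of_le (by linarith),
    ← intervalIntegral.integral_add_adjacent_intervals i1 i2, intervalIntegral.integral_add i1 i3,
    intervalIntegral.integral_comp_sub_left]
  congr 2 <;> ring

theorem integrableOn_circWeight_mul {b c : ℝ} (hb : 0 < b) (hc : 0 < c) {G : ℝ → ℝ}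
    (hG : Continuous G) :
    IntegrableOn (fun φ => circWeight b c φ * G φ)
      (Icc (-(Real.pi / 2)) (3 * Real.pi / 2)) := by
  obtain ⟨C, hC, h⟩ := exists_circWeight_le hb hc
  refine Integrable.bdd_mul (c := C) hG.integrableOn_Icc
    (circWeight_measurable b c).aestronglyMeasurable ?_
  filter_upwards [ae_restrict_mem measurableSet_Icc] with φ hφ
  rw [Real.norm_eq_abs, abs_of_pos (circWeight_pos hb hc φ)]
  exact (h φ hφ).1

theorem integral_circMeasure_fold {b c : ℝ} (hb : 0 < b) (hc : 0 < c) {G : ℝ → ℝ}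
    (hG : Continuous G) :
    IntegrableOn (fun φ => circWeight b c φ * G φ +
      circWeight b c (Real.pi - φ) * G (Real.pi - φ)) (Ioo (-(Real.pi / 2)) (Real.pi / 2)) ∧
    ∫ φ, G φ ∂(circMeasure b c) = ∫ φ in Ioo (-(Real.pi / 2)) (Real.pi / 2),
      (circWeight b c φ * G φ + circWeight b c (Real.pi - φ) * G (Real.pi - φ)) := by
  have h := integral_fold (integrableOn_circWeight_mul hb hc hG)
  rw [integral_circMeasure hb hc]
  exact h

theorem exists_circWeight_pi_sub_le {b c : ℝ} (hb : 0 < b) (hc : 0 < c) :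
    ∃ C, 0 ≤ C ∧ ∀ φ ∈ Ioo (-(Real.pi / 2)) (Real.pi / 2),
      circWeight b c (Real.pi - φ) ≤ C * circWeight b c φ ∧
      circWeight b c φ ≤ C * circWeight b c (Real.pi - φ) := by
  obtain ⟨C, hC, h⟩ := exists_circWeight_le hb hc
  refine ⟨C ^ 2, by positivity, fun φ hφ => ?_⟩
  have hpi := Real.pi_pos
  obtain ⟨a1, a2⟩ := h φ ⟨hφ.1.le, by linarith [hφ.2]⟩
  obtain ⟨b1, b2⟩ := h (Real.pi - φ) ⟨by linarith [hφ.2], by linarith [hφ.1]⟩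
  have e : C ^ 2 * C⁻¹ = C := by field_simp
  exact ⟨b1.trans (e.symm.le.trans (by gcongr)), a1.trans (e.symm.le.trans (by gcongr))⟩

theorem integral_needle_circMeasure_le {h : ℝ → ℝ} {α β c : ℝ} (hc : 0 < c)
    (h_pos : ∀ x ∈ Icc (-1 : ℝ) 1, 0 < h x)
    (hint : IntegrableOn (jumpWeight h α β c) (Ioo (-1) 1)) {L m : ℕ} {C ε : ℝ}
    (hC : ∀ φ ∈ Ioo (-(Real.pi / 2)) (Real.pi / 2),
      circWeight (h 0) c (Real.pi - φ) ≤ C * circWeight (h 0) c φ)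
    (hm : ∀ φ ∈ Ioo (-(Real.pi / 2)) (Real.pi / 2),
      (needle L m φ ^ 2 + C * needle L m (Real.pi - φ) ^ 2) * (weightRatio h α β c φ)⁻¹ ≤ 1 + ε)
    {g : ℝ → ℝ} (hg : Continuous g) (hg0 : ∀ x, 0 ≤ g x) :
    ∫ φ, g (Real.sin φ) * needle L m φ ^ 2 ∂(circMeasure (h 0) c) ≤
      (1 + ε) * ∫ x in Ioo (-1 : ℝ) 1, g x * jumpWeight h α β c x := by
  have h0 := h_pos 0 (by norm_num)
  have hS := continuous_needle L m
  have hgs : Continuous fun φ => g (Real.sin φ) * needle L m φ ^ 2 :=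
    (hg.comp Real.continuous_sin).mul (hS.pow 2)
  obtain ⟨i1, e1⟩ := integral_circMeasure_fold h0 hc hgs
  have i2 : IntegrableOn (fun x => g x * jumpWeight h α β c x) (Ioo (-1) 1) := by
    obtain ⟨B, hB⟩ := (isCompact_Icc (a := (-1 : ℝ)) (b := 1)).exists_bound_of_continuousOn
      hg.continuousOn
    refine Integrable.bdd_mul (c := B) hint hg.aestronglyMeasurable ?_
    filter_upwards [ae_restrict_mem measurableSet_Ioo] with x hx
    exact hB x (Ioo_subset_Icc_self hx)
  rw [e1, integral_sin_substitution, ← integral_const_mul]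
  refine setIntegral_mono_on i1 (((integrableOn_sin_substitution _).1 i2).const_mul _)
    measurableSet_Ioo fun φ hφ => ?_
  have hr := weightRatio_pos h_pos α β c hφ
  have hW := circWeight_pos h0 hc φ
  have hg1 := hg0 (Real.sin φ)
  rw [Real.sin_pi_sub]
  have e2 : Real.cos φ * (g (Real.sin φ) * jumpWeight h α β c (Real.sin φ)) =
      g (Real.sin φ) * (weightRatio h α β c φ * circWeight (h 0) c φ) := by
    rw [← jumpWeight_sin_mul_cos h0.ne' α β c hφ]; ring
  rw [e2]
  have h1 : needle L m φ ^ 2 + C * needle L m (Real.pi - φ) ^ 2 ≤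
      (1 + ε) * weightRatio h α β c φ := by
    have := hm φ hφ
    rwa [← div_eq_mul_inv, div_le_iff₀ hr] at this
  calc _ ≤ circWeight (h 0) c φ * (g (Real.sin φ) * needle L m φ ^ 2) +
        C * circWeight (h 0) c φ * (g (Real.sin φ) * needle L m (Real.pi - φ) ^ 2) := by
        gcongr
        exact hC φ hφ
    _ = g (Real.sin φ) * circWeight (h 0) c φ *
        (needle L m φ ^ 2 + C * needle L m (Real.pi - φ) ^ 2) := by ring
    _ ≤ g (Real.sin φ) * circWeight (h 0) c φ * ((1 + ε) * weightRatio h α β c φ) := by gcongr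
    _ = _ := by ring

theorem norm_add_sq_le_mul {a b x y : ℂ} {s t : ℝ} (hs : 0 < s) (ht : 0 < t) :
    ‖a * x + b * y‖ ^ 2 ≤ (s * ‖a‖ ^ 2 + t * ‖b‖ ^ 2) * (‖x‖ ^ 2 / s + ‖y‖ ^ 2 / t) := by
  have h1 : ‖a * x + b * y‖ ≤ ‖a‖ * ‖x‖ + ‖b‖ * ‖y‖ := by
    refine (norm_add_le _ _).trans ?_
    rw [norm_mul, norm_mul]
  have h2 : (‖a‖ * ‖x‖ + ‖b‖ * ‖y‖) ^ 2 + (s * ‖a‖ * ‖y‖ - t * ‖b‖ * ‖x‖) ^ 2 / (s * t) =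
      (s * ‖a‖ ^ 2 + t * ‖b‖ ^ 2) * (‖x‖ ^ 2 / s + ‖y‖ ^ 2 / t) := by
    field_simp; ring
  rw [← h2]
  have : 0 ≤ (s * ‖a‖ * ‖y‖ - t * ‖b‖ * ‖x‖) ^ 2 / (s * t) := by positivity
  have h3 : ‖a * x + b * y‖ ^ 2 ≤ (‖a‖ * ‖x‖ + ‖b‖ * ‖y‖) ^ 2 := by gcongr
  linarith

theorem integral_jumpWeight_le {h : ℝ → ℝ} {α β c : ℝ} (hc : 0 < c)
    (h_pos : ∀ x ∈ Icc (-1 : ℝ) 1, 0 < h x) {L m : ℕ} {C ε : ℝ}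
    (hC : ∀ φ ∈ Ioo (-(Real.pi / 2)) (Real.pi / 2),
      circWeight (h 0) c φ ≤ C * circWeight (h 0) c (Real.pi - φ))
    (hm : ∀ φ ∈ Ioo (-(Real.pi / 2)) (Real.pi / 2),
      (needle L m φ ^ 2 + C * needle L m (Real.pi - φ) ^ 2) * weightRatio h α β c φ ≤ 1 + ε)
    {g : ℝ → ℝ} {f : ℝ → ℂ} (hf : Continuous f)
    (hfg : ∀ φ, |g (Real.sin φ)| ≤
      ‖f φ * needle L m φ + f (Real.pi - φ) * needle L m (Real.pi - φ)‖) :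
    ∫ x in Ioo (-1 : ℝ) 1, g x ^ 2 * jumpWeight h α β c x ≤
      (1 + ε) * ∫ φ, ‖f φ‖ ^ 2 ∂(circMeasure (h 0) c) := by
  have h0 := h_pos 0 (by norm_num)
  obtain ⟨i1, e1⟩ := integral_circMeasure_fold h0 hc (hf.norm.pow 2)
  simp only [Pi.pow_apply] at e1 i1
  rw [e1, integral_sin_substitution, ← integral_const_mul]
  have key : ∀ φ ∈ Ioo (-(Real.pi / 2)) (Real.pi / 2),
      Real.cos φ * (g (Real.sin φ) ^ 2 * jumpWeight h α β c (Real.sin φ)) =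
      g (Real.sin φ) ^ 2 * (weightRatio h α β c φ * circWeight (h 0) c φ) := by
    intro φ hφ
    rw [← jumpWeight_sin_mul_cos h0.ne' α β c hφ]; ring
  refine integral_mono_of_nonneg ?_ (i1.const_mul _) ?_
  · filter_upwards [ae_restrict_mem measurableSet_Ioo] with φ hφ
    rw [key φ hφ]
    have := weightRatio_pos h_pos α β c hφ
    have := circWeight_pos h0 hc φ
    simp only [Pi.zero_apply]
    positivity
  · filter_upwards [ae_restrict_mem measurableSet_Ioo] with φ hφ
    rw [key φ hφ]
    have hr := weightRatio_pos h_pos α β c hφ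
    have hW := circWeight_pos h0 hc φ
    have hW' := circWeight_pos h0 hc (Real.pi - φ)
    have h1 : g (Real.sin φ) ^ 2 ≤
        ‖f φ * needle L m φ + f (Real.pi - φ) * needle L m (Real.pi - φ)‖ ^ 2 := by
      rw [← sq_abs]
      exact pow_le_pow_left₀ (abs_nonneg _) (hfg φ) 2
    have h2 := h1.trans (norm_add_sq_le_mul hW hW')
    rw [Complex.norm_real, Complex.norm_real, Real.norm_eq_abs, Real.norm_eq_abs, sq_abs, sq_abs] at h2
    have h3 : (needle L m φ ^ 2 / circWeight (h 0) c φ +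
        needle L m (Real.pi - φ) ^ 2 / circWeight (h 0) c (Real.pi - φ)) *
        (weightRatio h α β c φ * circWeight (h 0) c φ) ≤ 1 + ε := by
      refine le_trans ?_ (hm φ hφ)
      have : circWeight (h 0) c φ / circWeight (h 0) c (Real.pi - φ) ≤ C :=
        (div_le_iff₀ hW').2 (hC φ hφ)
      calc _ = (needle L m φ ^ 2 + circWeight (h 0) c φ / circWeight (h 0) c (Real.pi - φ) *
            needle L m (Real.pi - φ) ^ 2) * weightRatio h α β c φ := by field_simp
        _ ≤ _ := by gcongr
    calc _ ≤ _ := mul_le_mul_of_nonneg_right h2 (by positivity)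
      _ = (circWeight (h 0) c φ * ‖f φ‖ ^ 2 +
          circWeight (h 0) c (Real.pi - φ) * ‖f (Real.pi - φ)‖ ^ 2) * ((needle L m φ ^ 2 /
            circWeight (h 0) c φ + needle L m (Real.pi - φ) ^ 2 /
            circWeight (h 0) c (Real.pi - φ)) *
          (weightRatio h α β c φ * circWeight (h 0) c φ)) := by ring
      _ ≤ (circWeight (h 0) c φ * ‖f φ‖ ^ 2 +
          circWeight (h 0) c (Real.pi - φ) * ‖f (Real.pi - φ)‖ ^ 2) * (1 + ε) := by gcongr
      _ = _ := by ring

/-- Comparison of the jump weight on `[-1,1]` with the model weight on the circle. -/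
theorem exists_needle_comparison {h : ℝ → ℝ} (hh : ContinuousOn h (Icc (-1) 1)) {α β c : ℝ}
    (hc : 0 < c) (h_pos : ∀ x ∈ Icc (-1 : ℝ) 1, 0 < h x)
    (hint : IntegrableOn (jumpWeight h α β c) (Ioo (-1) 1)) :
    ∃ L : ℕ, ∀ ε > 0, ∀ᶠ m in atTop,
      (∀ g : ℝ → ℝ, Continuous g → (∀ x, 0 ≤ g x) →
        ∫ φ, g (Real.sin φ) * needle L m φ ^ 2 ∂(circMeasure (h 0) c) ≤
          (1 + ε) * ∫ x in Ioo (-1 : ℝ) 1, g x * jumpWeight h α β c x) ∧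
      (∀ (g : ℝ → ℝ) (f : ℝ → ℂ), Continuous f →
        (∀ φ, |g (Real.sin φ)| ≤
          ‖f φ * needle L m φ + f (Real.pi - φ) * needle L m (Real.pi - φ)‖) →
        ∫ x in Ioo (-1 : ℝ) 1, g x ^ 2 * jumpWeight h α β c x ≤
          (1 + ε) * ∫ φ, ‖f φ‖ ^ 2 ∂(circMeasure (h 0) c)) := by
  have h0 := h_pos 0 (by norm_num)
  obtain ⟨L, B, hB⟩ := exists_cos_pow_mul_weightRatio_inv_le hh h_pos α β c
  obtain ⟨C, hC0, hC⟩ := exists_circWeight_pi_sub_le h0 hc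
  have hr := continuousAt_weightRatio hh α β c
  have hr0 := weightRatio_zero h0.ne' α β c
  refine ⟨L, fun ε hε => ?_⟩
  have a1 := eventually_needle_mul_le hr hr0 hC0
    (fun φ hφ => ⟨(weightRatio_pos h_pos α β c hφ).le, (hB φ hφ).1⟩) hε
  have a2 := eventually_needle_mul_le (r := fun φ => (weightRatio h α β c φ)⁻¹)
    (hr.inv₀ (by rw [hr0]; exact one_ne_zero)) (by simp [hr0]) hC0
    (fun φ hφ => ⟨(inv_pos.2 (weightRatio_pos h_pos α β c hφ)).le, (hB φ hφ).2⟩) hε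
  filter_upwards [a1, a2] with m h1 h2
  exact ⟨fun g hg hg0 => integral_needle_circMeasure_le hc h_pos hint (fun φ hφ => (hC φ hφ).1)
    h2 hg hg0, fun g f hf hfg => integral_jumpWeight_le hc h_pos
    (fun φ hφ => (hC φ hφ).2) h1 hf hfg⟩

/-- The Christoffel–Darboux kernel. -/
noncomputable def cdKernel (p : ℕ → Polynomial ℝ) (n : ℕ) (x y : ℝ) : ℝ :=
  ∑ k ∈ Finset.range n, (p k).eval x * (p k).eval y

theorem exists_eq_sum_mul_of_natDegree_lt {p : ℕ → Polynomial ℝ} (hp_deg : ∀ n, (p n).natDegree = n)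
    (hp_lead : ∀ n, 0 < (p n).leadingCoeff) {n : ℕ} {P : Polynomial ℝ}
    (hP : P.degree < n) :
    ∃ a : ℕ → ℝ, P = ∑ k ∈ Finset.range n, Polynomial.C (a k) * p k := by
  induction n generalizing P with
  | zero => exact ⟨0, by simpa [Polynomial.degree_eq_bot] using hP⟩
  | succ n ih =>
    have hl := (hp_lead n).ne'
    have hl' : (p n).coeff n ≠ 0 := by
      have h := hl
      rwa [Polynomial.leadingCoeff, hp_deg] at h
    set t := P.coeff n / (p n).coeff n with ht
    have hle : (P - Polynomial.C t * p n).degree < n := by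
      rw [Polynomial.degree_lt_iff_coeff_zero] at hP ⊢
      intro m hm
      rw [Polynomial.coeff_sub, Polynomial.coeff_C_mul]
      rcases hm.eq_or_lt with rfl | hm
      · rw [ht]; field_simp; ring
      · rw [hP m hm, Polynomial.coeff_eq_zero_of_natDegree_lt (by rwa [hp_deg])]; ring
    obtain ⟨a, ha⟩ := ih hle
    refine ⟨Function.update a n t, ?_⟩
    rw [Finset.sum_range_succ, Function.update_self, ← sub_eq_iff_eq_add, ha]
    refine Finset.sum_congr rfl fun k hk => ?_
    rw [Function.update_of_ne (Finset.mem_range.1 hk).ne]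

theorem integrableOn_eval_mul {w : ℝ → ℝ} (hint : IntegrableOn w (Ioo (-1) 1)) {g : ℝ → ℝ}
    (hg : Continuous g) : IntegrableOn (fun x => g x * w x) (Ioo (-1) 1) := by
  obtain ⟨B, hB⟩ := (isCompact_Icc (a := (-1 : ℝ)) (b := 1)).exists_bound_of_continuousOn
    hg.continuousOn
  refine Integrable.bdd_mul (c := B) hint hg.aestronglyMeasurable ?_
  filter_upwards [ae_restrict_mem measurableSet_Ioo] with x hx
  exact hB x (Ioo_subset_Icc_self hx)

theorem integral_sum_sq_mul {w : ℝ → ℝ} (hint : IntegrableOn w (Ioo (-1) 1))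
    {p : ℕ → Polynomial ℝ}
    (hp_orth : ∀ m n : ℕ, ∫ x in Ioo (-1 : ℝ) 1, (p m).eval x * (p n).eval x * w x =
      if m = n then 1 else 0) (n : ℕ) (a : ℕ → ℝ) :
    ∫ x in Ioo (-1 : ℝ) 1, (∑ k ∈ Finset.range n, a k * (p k).eval x) ^ 2 * w x =
      ∑ k ∈ Finset.range n, a k ^ 2 := by
  have e : ∀ x, (∑ k ∈ Finset.range n, a k * (p k).eval x) ^ 2 * w x =
      ∑ i ∈ Finset.range n, ∑ j ∈ Finset.range n,
        a i * a j * ((p i).eval x * (p j).eval x * w x) := by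
    intro x
    rw [sq, Finset.sum_mul_sum, Finset.sum_mul]
    refine Finset.sum_congr rfl fun i _ => ?_
    rw [Finset.sum_mul]
    exact Finset.sum_congr rfl fun j _ => by ring
  have hi : ∀ i j, IntegrableOn (fun x => a i * a j * ((p i).eval x * (p j).eval x * w x))
      (Ioo (-1) 1) := fun i j =>
    (integrableOn_eval_mul hint ((p i).continuous.mul (p j).continuous)).const_mul _
  simp only [e]
  rw [integral_finsetSum _ fun i _ => integrable_finsetSum _ fun j _ => hi i j]
  refine Finset.sum_congr rfl fun i hi' => ?_
  rw [integral_finsetSum _ fun j _ => hi i j]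
  simp only [integral_const_mul, hp_orth]
  simp [Finset.mem_range.1 hi', sq]

theorem eval_sq_le_cdKernel_mul {w : ℝ → ℝ} (hint : IntegrableOn w (Ioo (-1) 1))
    {p : ℕ → Polynomial ℝ} (hp_deg : ∀ n, (p n).natDegree = n)
    (hp_lead : ∀ n, 0 < (p n).leadingCoeff)
    (hp_orth : ∀ m n : ℕ, ∫ x in Ioo (-1 : ℝ) 1, (p m).eval x * (p n).eval x * w x =
      if m = n then 1 else 0) {n : ℕ} {P : Polynomial ℝ} (hP : P.natDegree < n) (y : ℝ) :
    P.eval y ^ 2 ≤ cdKernel p n y y * ∫ x in Ioo (-1 : ℝ) 1, P.eval x ^ 2 * w x := by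
  obtain ⟨a, rfl⟩ := exists_eq_sum_mul_of_natDegree_lt hp_deg hp_lead
    (P.degree_le_natDegree.trans_lt (by exact_mod_cast hP))
  simp only [Polynomial.eval_finsetSum, Polynomial.eval_mul, Polynomial.eval_C]
  rw [integral_sum_sq_mul hint hp_orth, mul_comm, cdKernel]
  simpa only [sq ((p _).eval y)] using Finset.sum_mul_sq_le_sq_mul_sq (Finset.range n) a
    (fun k => (p k).eval y)

theorem integral_cdKernel_sq {w : ℝ → ℝ} (hint : IntegrableOn w (Ioo (-1) 1))
    {p : ℕ → Polynomial ℝ}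
    (hp_orth : ∀ m n : ℕ, ∫ x in Ioo (-1 : ℝ) 1, (p m).eval x * (p n).eval x * w x =
      if m = n then 1 else 0) (n : ℕ) (y : ℝ) :
    ∫ x in Ioo (-1 : ℝ) 1, cdKernel p n y x ^ 2 * w x = cdKernel p n y y := by
  simp only [cdKernel]
  rw [integral_sum_sq_mul hint hp_orth n fun k => (p k).eval y]
  simp only [sq]

theorem cdKernel_sin_mem_trigPoly {p : ℕ → Polynomial ℝ} (hp_deg : ∀ n, (p n).natDegree = n)
    (n : ℕ) (y : ℝ) : (fun φ => (cdKernel p n y (Real.sin φ) : ℂ)) ∈ trigPoly n := by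
  have h : (∑ k ∈ Finset.range n, Polynomial.C ((p k).eval y) * p k).natDegree ≤ n := by
    refine Polynomial.natDegree_sum_le_of_forall_le _ _ fun k hk => ?_
    refine (Polynomial.natDegree_C_mul_le _ _).trans ?_
    rw [hp_deg]; exact (Finset.mem_range.1 hk).le
  have := eval_sin_mem_trigPoly h
  simpa [cdKernel, Polynomial.eval_finsetSum] using this

theorem continuous_cdKernel (p : ℕ → Polynomial ℝ) (n : ℕ) (y : ℝ) :
    Continuous (cdKernel p n y) := by
  unfold cdKernel
  refine continuous_finsetSum _ fun k _ => continuous_const.mul (p k).continuous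

theorem integrableOn_of_orthonormal {w : ℝ → ℝ} {p : ℕ → Polynomial ℝ}
    (hp_deg : ∀ n, (p n).natDegree = n)
    (hp_orth : ∀ m n : ℕ, ∫ x in Ioo (-1 : ℝ) 1, (p m).eval x * (p n).eval x * w x =
      if m = n then 1 else 0) : IntegrableOn w (Ioo (-1) 1) := by
  obtain ⟨a, ha⟩ := Polynomial.natDegree_eq_zero.1 (hp_deg 0)
  have h := hp_orth 0 0
  simp only [← ha, Polynomial.eval_C, if_true] at h
  by_contra hn
  have ha0 : a * a ≠ 0 := fun h0 => by simp [h0] at h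
  rw [integral_undef] at h
  · exact zero_ne_one h
  · intro hi
    refine hn ((hi.const_mul (a * a)⁻¹).congr (Eventually.of_forall fun x => ?_))
    exact inv_mul_cancel_left₀ ha0 (w x)

theorem cdKernel_self_nonneg (p : ℕ → Polynomial ℝ) (n : ℕ) (y : ℝ) : 0 ≤ cdKernel p n y y :=
  Finset.sum_nonneg fun _ _ => mul_self_nonneg _

theorem norm_cdKernel_mul_needle_sub_sq_le {w : ℝ → ℝ} (hint : IntegrableOn w (Ioo (-1) 1))
    {p : ℕ → Polynomial ℝ} (hp_deg : ∀ n, (p n).natDegree = n)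
    (hp_orth : ∀ m n : ℕ, ∫ x in Ioo (-1 : ℝ) 1, (p m).eval x * (p n).eval x * w x =
      if m = n then 1 else 0) {b c : ℝ} (hb : 0 < b) (hc : 0 < c) (hc1 : c ≠ 1) {L m : ℕ} {ε : ℝ}
    (hcmp : ∀ g : ℝ → ℝ, Continuous g → (∀ x, 0 ≤ g x) →
        ∫ φ, g (Real.sin φ) * needle L m φ ^ 2 ∂(circMeasure b c) ≤
          (1 + ε) * ∫ x in Ioo (-1 : ℝ) 1, g x * w x) (n : ℕ) (ψ θ : ℝ) :
    ‖((cdKernel p n (Real.sin ψ) (Real.sin θ) * needle L m θ : ℝ) : ℂ) -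
        trigKernel b c (n + (2 * L + m)) ψ θ‖ ^ 2 ≤ (trigKernel b c (n + (2 * L + m)) θ θ).re *
      ((trigKernel b c (n + (2 * L + m)) ψ ψ).re -
        (2 * needle L m ψ - (1 + ε)) * cdKernel p n (Real.sin ψ) (Real.sin ψ)) := by
  have hmem : (fun φ => ((cdKernel p n (Real.sin ψ) (Real.sin φ) * needle L m φ : ℝ) : ℂ)) ∈
      trigPoly (n + (2 * L + m)) := by
    convert mul_mem_trigPoly (cdKernel_sin_mem_trigPoly hp_deg n (Real.sin ψ))
      (needle_mem_trigPoly L m) using 1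
    ext φ; simp
  refine (norm_sub_trigKernel_sq_le hb hc hc1 ψ θ hmem).trans ?_
  refine mul_le_mul_of_nonneg_left ?_ (trigKernel_self_nonneg hb hc hc1 _ _)
  have h := hcmp (fun x => cdKernel p n (Real.sin ψ) x ^ 2)
    ((continuous_cdKernel p n _).pow 2) fun x => sq_nonneg _
  rw [integral_cdKernel_sq hint hp_orth] at h
  simp only [mul_pow]
  linarith

theorem trigKernel_self_mul_le_cdKernel {w : ℝ → ℝ} (hint : IntegrableOn w (Ioo (-1) 1))
    {p : ℕ → Polynomial ℝ} (hp_deg : ∀ n, (p n).natDegree = n)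
    (hp_lead : ∀ n, 0 < (p n).leadingCoeff)
    (hp_orth : ∀ m n : ℕ, ∫ x in Ioo (-1 : ℝ) 1, (p m).eval x * (p n).eval x * w x =
      if m = n then 1 else 0) {b c : ℝ} (hb : 0 < b) (hc : 0 < c) (hc1 : c ≠ 1) {L m : ℕ} {ε : ℝ}
    (hε : 0 < ε)
    (hcmp : ∀ (g : ℝ → ℝ) (f : ℝ → ℂ), Continuous f →
        (∀ φ, |g (Real.sin φ)| ≤
          ‖f φ * needle L m φ + f (Real.pi - φ) * needle L m (Real.pi - φ)‖) →
        ∫ x in Ioo (-1 : ℝ) 1, g x ^ 2 * w x ≤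
          (1 + ε) * ∫ φ, ‖f φ‖ ^ 2 ∂(circMeasure b c)) {n d : ℕ}
    (hd : d + 1 + (2 * L + m) < n) {ψ : ℝ} (hψ : 0 < Real.cos ψ) :
    (trigKernel b c d ψ ψ).re * (needle L m ψ * Real.cos ψ) ^ 2 ≤
      (1 + ε) * cdKernel p n (Real.sin ψ) (Real.sin ψ) := by
  have hTm := trigKernel_mem b c d ψ
  set T := trigKernel b c d ψ with hT
  set f : ℝ → ℂ := fun φ => T φ * (((Real.cos φ + Real.cos ψ) / (2 * Real.cos ψ) : ℝ) : ℂ) with hf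
  have hfm : f ∈ trigPoly (d + 1) := by
    have := mul_mem_trigPoly hTm ((trigPoly 1).smul_mem (((2 * Real.cos ψ)⁻¹ : ℝ) : ℂ)
      (add_mem cos_mem_trigPoly ((trigPoly 1).smul_mem ((Real.cos ψ : ℝ) : ℂ) (one_mem_trigPoly 1))))
    convert this using 1
    ext φ
    simp [hf]
    left
    ring
  have hF := mul_mem_trigPoly hfm (needle_mem_trigPoly L m)
  obtain ⟨P, hPd, hP⟩ := exists_polynomial_symm hF
  simp only [Pi.mul_apply] at hP
  have hfc := continuous_of_mem_trigPoly hfm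
  have hTc := continuous_of_mem_trigPoly hTm
  have h1 := hcmp (fun x => P.eval x) f hfc fun φ => by
    rw [hP]; exact Complex.abs_re_le_norm _
  have h2 := eval_sq_le_cdKernel_mul hint hp_deg hp_lead hp_orth (hPd.trans_lt hd) (Real.sin ψ)
  have h3 : P.eval (Real.sin ψ) = (T ψ).re * needle L m ψ := by
    have e1 : f (Real.pi - ψ) = 0 := by
      simp only [hf, Real.cos_pi_sub, neg_add_cancel, zero_div]; simp
    have e2 : f ψ = T ψ := by
      have : (Real.cos ψ + Real.cos ψ) / (2 * Real.cos ψ) = 1 := by field_simp; ring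
      simp only [hf, this]; simp
    rw [hP, e1, e2, zero_mul, add_zero, Complex.re_mul_ofReal]
  have h4 : ∫ φ, ‖f φ‖ ^ 2 ∂(circMeasure b c) ≤ (T ψ).re / Real.cos ψ ^ 2 := by
    rw [hT, ← integral_norm_trigKernel_sq hb hc hc1 d ψ, div_eq_inv_mul, ← integral_const_mul]
    refine integral_mono (Continuous.integrable_circMeasure hb hc (by fun_prop))
      (Continuous.integrable_circMeasure hb hc (continuous_const.mul (hTc.norm.pow 2))) fun φ => ?_
    simp only [hf, norm_mul, mul_pow]
    rw [mul_comm, Complex.norm_real, Real.norm_eq_abs, sq_abs]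
    gcongr ?_ * _
    rw [← inv_pow, ← sq_abs, ← sq_abs (Real.cos ψ)⁻¹]
    gcongr ?_ ^ 2
    have := Real.abs_cos_le_one φ
    have h5 := Real.cos_le_one ψ
    rw [abs_div, abs_of_pos (show 0 < 2 * Real.cos ψ by positivity),
      abs_of_pos (inv_pos.2 hψ), div_le_iff₀ (by positivity)]
    have : (Real.cos ψ)⁻¹ * (2 * Real.cos ψ) = 2 := by field_simp
    rw [this, abs_le]
    constructor <;> linarith [Real.cos_le_one φ, Real.neg_one_le_cos φ]
  have ha := cdKernel_self_nonneg p n (Real.sin ψ)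
  have hT0 : 0 ≤ (T ψ).re := trigKernel_self_nonneg hb hc hc1 d ψ
  rw [h3] at h2
  rcases hT0.eq_or_lt with h0 | h0
  · rw [← h0, zero_mul]; positivity
  · have h5 : ((T ψ).re * needle L m ψ) ^ 2 ≤ cdKernel p n (Real.sin ψ) (Real.sin ψ) *
        ((1 + ε) * ((T ψ).re / Real.cos ψ ^ 2)) := by
      refine h2.trans ?_
      gcongr
      exact h1.trans (by gcongr)
    have h6 : (T ψ).re * ((T ψ).re * (needle L m ψ * Real.cos ψ) ^ 2) ≤
        (T ψ).re * ((1 + ε) * cdKernel p n (Real.sin ψ) (Real.sin ψ)) := by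
      calc _ = ((T ψ).re * needle L m ψ) ^ 2 * Real.cos ψ ^ 2 := by ring
        _ ≤ cdKernel p n (Real.sin ψ) (Real.sin ψ) *
        ((1 + ε) * ((T ψ).re / Real.cos ψ ^ 2)) * Real.cos ψ ^ 2 := by gcongr
        _ = _ := by field_simp
    exact le_of_mul_le_mul_left h6 h0

theorem norm_ascPochhammer_eval_le (a : ℂ) (k : ℕ) :
    ‖(ascPochhammer ℂ k).eval a‖ ≤ (1 + ‖a‖) ^ k * k.factorial := by
  induction k with
  | zero => simp
  | succ k ih =>
    rw [ascPochhammer_succ_eval, norm_mul, Nat.factorial_succ, pow_succ]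
    have h1 : ‖a + k‖ ≤ (1 + ‖a‖) * (k + 1) := by
      refine (norm_add_le _ _).trans ?_
      rw [Complex.norm_natCast]
      nlinarith [norm_nonneg a, (Nat.cast_nonneg k : (0 : ℝ) ≤ k),
        mul_nonneg (norm_nonneg a) (Nat.cast_nonneg k : (0 : ℝ) ≤ k)]
    calc _ ≤ ((1 + ‖a‖) ^ k * k.factorial) * ((1 + ‖a‖) * (k + 1)) := by gcongr
      _ = _ := by push_cast; ring

/-- Taylor coefficients of the Kummer function `₁F₁(a; 1; ·)`. -/
noncomputable def kummerCoeff (a : ℂ) (k : ℕ) : ℂ :=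
  (ascPochhammer ℂ k).eval a / ((Nat.factorial k : ℂ)) ^ 2

theorem norm_kummerCoeff_le (a : ℂ) (k : ℕ) :
    ‖kummerCoeff a k‖ ≤ (1 + ‖a‖) ^ k / k.factorial := by
  have h0 : (0 : ℝ) < k.factorial := by positivity
  rw [kummerCoeff, norm_div, norm_pow, Complex.norm_natCast, div_le_div_iff₀ (by positivity) h0]
  calc _ ≤ ((1 + ‖a‖) ^ k * k.factorial) * k.factorial := by
        gcongr; exact norm_ascPochhammer_eval_le a k
    _ = _ := by ring

theorem norm_kummerCoeff_mul_le (a : ℂ) {R : ℝ} {k : ℕ} {z : ℂ} (hz : ‖z‖ ≤ R ^ k) :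
    ‖kummerCoeff a k * z‖ ≤ ((1 + ‖a‖) * R) ^ k / k.factorial := by
  rw [norm_mul, mul_pow, mul_div_right_comm]
  exact mul_le_mul (norm_kummerCoeff_le a k) hz (norm_nonneg _) (by positivity)

theorem summable_kummerCoeff_mul (a : ℂ) {R : ℝ} {F : ℕ → ℂ} (hF : ∀ k, ‖F k‖ ≤ R ^ k) :
    Summable fun k => kummerCoeff a k * F k :=
  .of_norm_bounded (Real.summable_pow_div_factorial _) fun k => norm_kummerCoeff_mul_le a (hF k)

theorem tendsto_tsum_kummerCoeff_mul {ι : Type*} {l : Filter ι} (a : ℂ) {F : ι → ℕ → ℂ}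
    {F₀ : ℕ → ℂ} {R : ℝ} (hF : ∀ k, Tendsto (fun i => F i k) l (nhds (F₀ k)))
    (hR : ∀ᶠ i in l, ∀ k, ‖F i k‖ ≤ R ^ k) :
    Tendsto (fun i => ∑' k, kummerCoeff a k * F i k) l (nhds (∑' k, kummerCoeff a k * F₀ k)) :=
  tendsto_tsum_of_dominated_convergence (Real.summable_pow_div_factorial ((1 + ‖a‖) * R))
    (fun k => (hF k).const_mul _) (hR.mono fun _ hi k => norm_kummerCoeff_mul_le a (hi k))

/-- The divided difference of the `k`-th power. -/
def powDiff (x y : ℂ) (k : ℕ) : ℂ := ∑ i ∈ Finset.range k, x ^ i * y ^ (k - 1 - i)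

theorem sub_mul_powDiff (x y : ℂ) (k : ℕ) : (x - y) * powDiff x y k = x ^ k - y ^ k := by
  rw [mul_comm]; exact geom_sum₂_mul x y k

theorem norm_powDiff_le {x y : ℂ} {R : ℝ} (hR : 1 ≤ R) (hx : ‖x‖ ≤ R) (hy : ‖y‖ ≤ R) (k : ℕ) :
    ‖powDiff x y k‖ ≤ (2 * R) ^ k := by
  have h : ∀ i ∈ Finset.range k, ‖x ^ i * y ^ (k - 1 - i)‖ ≤ R ^ k := by
    intro i hi
    rw [norm_mul, norm_pow, norm_pow]
    calc ‖x‖ ^ i * ‖y‖ ^ (k - 1 - i) ≤ R ^ i * R ^ (k - 1 - i) := by gcongr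
      _ = R ^ (i + (k - 1 - i)) := by rw [pow_add]
      _ ≤ R ^ k := pow_le_pow_right₀ hR (by have := Finset.mem_range.1 hi; omega)
  refine (norm_sum_le_of_le _ h).trans ?_
  rw [Finset.sum_const, Finset.card_range, nsmul_eq_mul, mul_pow]
  have : (k : ℝ) ≤ 2 ^ k := by exact_mod_cast (Nat.lt_two_pow_self (n := k)).le
  gcongr

theorem Filter.Tendsto.powDiff {ι : Type*} {l : Filter ι} {x y : ι → ℂ} {x₀ y₀ : ℂ}
    (hx : Tendsto x l (nhds x₀)) (hy : Tendsto y l (nhds y₀)) (k : ℕ) :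
    Tendsto (fun i => powDiff (x i) (y i) k) l (nhds (powDiff x₀ y₀ k)) :=
  tendsto_finsetSum _ fun _ _ => (hx.pow _).mul (hy.pow _)

theorem exists_eventually_norm_le {ι : Type*} {l : Filter ι} {x : ι → ℂ} {x₀ : ℂ}
    (hx : Tendsto x l (nhds x₀)) : ∀ᶠ i in l, ‖x i‖ ≤ ‖x₀‖ + 1 :=
  (hx.norm.eventually (gt_mem_nhds (lt_add_one _))).mono fun _ h => h.le

/-- The Kummer function `₁F₁(a; 1; ζ)`. -/
noncomputable def kummer (a ζ : ℂ) : ℂ := ∑' k, kummerCoeff a k * ζ ^ k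

/-- The divided difference of `kummer a`. -/
noncomputable def kummerDiff (a ζ η : ℂ) : ℂ := ∑' k, kummerCoeff a k * powDiff ζ η k

theorem sub_mul_kummerDiff (a ζ η : ℂ) : (ζ - η) * kummerDiff a ζ η = kummer a ζ - kummer a η := by
  rw [kummerDiff, kummer, kummer, ← tsum_mul_left,
    ← (summable_kummerCoeff_mul a fun k => (norm_pow ζ k).le).tsum_sub
      (summable_kummerCoeff_mul a fun k => (norm_pow η k).le)]
  refine tsum_congr fun k => ?_
  rw [← mul_sub, ← sub_mul_powDiff]; ring

theorem tendsto_tsum_mul_pow {ι : Type*} {l : Filter ι} (a : ℂ) {γ : ι → ℕ → ℂ} {ζ : ι → ℂ}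
    {ζ₀ : ℂ} (hγ1 : ∀ᶠ i in l, ∀ k, ‖γ i k‖ ≤ 1) (hγ : ∀ k, Tendsto (fun i => γ i k) l (nhds 1))
    (hζ : Tendsto ζ l (nhds ζ₀)) :
    Tendsto (fun i => ∑' k, kummerCoeff a k * (γ i k * ζ i ^ k)) l (nhds (kummer a ζ₀)) := by
  refine tendsto_tsum_kummerCoeff_mul (R := ‖ζ₀‖ + 1) a
    (fun k => by simpa using (hγ k).mul (hζ.pow k)) ?_
  filter_upwards [exists_eventually_norm_le hζ, hγ1] with i hi h1 k
  rw [norm_mul, norm_pow]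
  calc ‖γ i k‖ * ‖ζ i‖ ^ k ≤ 1 * (‖ζ₀‖ + 1) ^ k := by gcongr; exact h1 k
    _ = _ := one_mul _

theorem tendsto_tsum_mul_powDiff {ι : Type*} {l : Filter ι} (a : ℂ) {γ : ι → ℕ → ℂ} {ζ η : ι → ℂ}
    {ζ₀ η₀ : ℂ} (hγ1 : ∀ᶠ i in l, ∀ k, ‖γ i k‖ ≤ 1)
    (hγ : ∀ k, Tendsto (fun i => γ i k) l (nhds 1))
    (hζ : Tendsto ζ l (nhds ζ₀)) (hη : Tendsto η l (nhds η₀)) :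
    Tendsto (fun i => ∑' k, kummerCoeff a k * (γ i k * powDiff (ζ i) (η i) k)) l
      (nhds (kummerDiff a ζ₀ η₀)) := by
  refine tendsto_tsum_kummerCoeff_mul (R := 2 * (‖ζ₀‖ + 1 + ‖η₀‖)) a
    (fun k => by simpa using (hγ k).mul (hζ.powDiff hη k)) ?_
  filter_upwards [exists_eventually_norm_le hζ, exists_eventually_norm_le hη, hγ1] with i hi hj h1 k
  have hζn := norm_nonneg ζ₀
  have hηn := norm_nonneg η₀
  rw [norm_mul]
  calc ‖γ i k‖ * ‖powDiff (ζ i) (η i) k‖ ≤ 1 * (2 * (‖ζ₀‖ + 1 + ‖η₀‖)) ^ k := by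
        gcongr
        · exact h1 k
        · exact norm_powDiff_le (by linarith) (by linarith) (by linarith) k
    _ = _ := one_mul _

theorem hasDerivAt_kummer (a ζ : ℂ) : HasDerivAt (kummer a) (kummerDiff a ζ ζ) ζ := by
  rw [hasDerivAt_iff_tendsto_slope]
  have h := tendsto_tsum_mul_powDiff (l := nhdsWithin ζ {ζ}ᶜ) a (γ := fun _ _ => 1)
    (ζ := fun z => z) (η := fun _ => ζ) (.of_forall fun _ _ => by simp)
    (fun _ => tendsto_const_nhds) (tendsto_id.mono_left nhdsWithin_le_nhds) tendsto_const_nhds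
  refine h.congr' ?_
  filter_upwards [self_mem_nhdsWithin] with z hz
  have hz : z - ζ ≠ 0 := sub_ne_zero.2 hz
  rw [slope_def_field, eq_div_iff hz, ← sub_mul_kummerDiff, mul_comm]
  simp [kummerDiff]

theorem Gfun_eq_kummer (a ζ : ℂ) : Gfun a ζ = Complex.exp (-ζ / 2) * kummer a ζ := rfl

theorem deriv_Gfun (a ζ : ℂ) :
    deriv (Gfun a) ζ = Complex.exp (-ζ / 2) * (kummerDiff a ζ ζ - kummer a ζ / 2) := by
  have h1 : HasDerivAt (fun ζ : ℂ => -ζ / 2) (-1 / 2) ζ := (hasDerivAt_id ζ).neg.div_const 2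
  have h2 := h1.cexp.mul (hasDerivAt_kummer a ζ)
  have h3 : Gfun a = (fun ζ => Complex.exp (-ζ / 2)) * kummer a := rfl
  rw [h3, h2.deriv]
  ring

/-- The ratio `N (N-1) ⋯ (N-k+1) / N ^ k`. -/
noncomputable def descRatio (N k : ℕ) : ℂ := (N.descFactorial k : ℂ) / (N : ℂ) ^ k

theorem norm_descRatio_le_one (N k : ℕ) : ‖descRatio N k‖ ≤ 1 := by
  rw [descRatio, norm_div, norm_pow, Complex.norm_natCast, Complex.norm_natCast]
  refine div_le_one_of_le₀ ?_ (by positivity)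
  exact_mod_cast Nat.descFactorial_le_pow N k

theorem tendsto_descRatio (k : ℕ) : Tendsto (fun N => descRatio N k) atTop (nhds 1) := by
  induction k with
  | zero => simp [descRatio]
  | succ k ih =>
    have h : Tendsto (fun N : ℕ => (1 - (k : ℂ) * (N : ℂ)⁻¹) * descRatio N k) atTop
        (nhds ((1 - k * 0) * 1)) :=
      (tendsto_const_nhds.sub (tendsto_const_nhds.mul
        (tendsto_inv_atTop_nhds_zero_nat (𝕜 := ℂ)))).mul ih
    rw [mul_zero, sub_zero, mul_one] at h
    refine h.congr' ?_
    filter_upwards [eventually_ge_atTop (k + 1)] with N hN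
    have hN0 : (N : ℂ) ≠ 0 := by exact_mod_cast (by omega : N ≠ 0)
    rw [descRatio, descRatio, Nat.descFactorial_succ, Nat.cast_mul, Nat.cast_sub (by omega)]
    field_simp
    ring

theorem tsum_descRatio_eq_sum (N : ℕ) (a : ℂ) (F : ℕ → ℂ) :
    ∑' k, kummerCoeff a k * (descRatio N k * F k) =
      ∑ k ∈ Finset.range (N + 1), kummerCoeff a k * (descRatio N k * F k) := by
  refine tsum_eq_sum fun k hk => ?_
  have : N.descFactorial k = 0 := Nat.descFactorial_eq_zero_iff_lt.2 (by simpa using hk)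
  simp [descRatio, this]

theorem szegoPoly_eq_tsum {N : ℕ} (hN : N ≠ 0) (a z : ℂ) :
    szegoPoly N a z = ∑' k, kummerCoeff a k * (descRatio N k * (N * (z - 1)) ^ k) := by
  rw [tsum_descRatio_eq_sum, szegoPoly]
  refine Finset.sum_congr rfl fun k _ => ?_
  have h1 : (k.factorial : ℂ) ≠ 0 := by exact_mod_cast k.factorial_ne_zero
  have h2 : (N : ℂ) ≠ 0 := by exact_mod_cast hN
  rw [kummerCoeff, descRatio, Nat.descFactorial_eq_factorial_mul_choose, mul_pow,
    show (z - 1) ^ k = (-1) ^ k * (1 - z) ^ k by rw [← mul_pow]; ring]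
  push_cast
  field_simp

theorem szegoKernel_eq {N : ℕ} (hN : N ≠ 0) (l z w : ℂ) :
    szegoKernel l N z w = N * (szegoPoly N l w *
        ∑' k, kummerCoeff (1 + l) k * (descRatio N k * powDiff (N * (z - 1)) (N * (w - 1)) k) -
      szegoPoly N (1 + l) w *
        ∑' k, kummerCoeff l k * (descRatio N k * powDiff (N * (z - 1)) (N * (w - 1)) k)) := by
  have hdiff (a z : ℂ) : N * (z - w) *
      ∑' k, kummerCoeff a k * (descRatio N k * powDiff (N * (z - 1)) (N * (w - 1)) k) =
      szegoPoly N a z - szegoPoly N a w := by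
    rw [szegoPoly_eq_tsum hN, szegoPoly_eq_tsum hN]
    simp only [tsum_descRatio_eq_sum]
    rw [Finset.mul_sum, ← Finset.sum_sub_distrib]
    refine Finset.sum_congr rfl fun k _ => ?_
    have := sub_mul_powDiff (N * (z - 1)) (N * (w - 1)) k
    linear_combination kummerCoeff a k * descRatio N k * this
  have hcont (a : ℂ) : Continuous fun z : ℂ =>
      ∑' k, kummerCoeff a k * (descRatio N k * powDiff (N * (z - 1)) (N * (w - 1)) k) := by
    simp only [tsum_descRatio_eq_sum, powDiff]
    fun_prop
  refine congrFun (Continuous.ext_on (dense_compl_singleton w) (continuous_szegoKernel l N w)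
    (g := fun z => N * (szegoPoly N l w *
        ∑' k, kummerCoeff (1 + l) k * (descRatio N k * powDiff (N * (z - 1)) (N * (w - 1)) k) -
      szegoPoly N (1 + l) w *
        ∑' k, kummerCoeff l k * (descRatio N k * powDiff (N * (z - 1)) (N * (w - 1)) k)))
    (continuous_const.mul ((continuous_const.mul (hcont _)).sub
      (continuous_const.mul (hcont _)))) ?_) z
  intro z hz
  have hz : z - w ≠ 0 := sub_ne_zero.2 hz
  refine mul_left_cancel₀ hz ?_
  rw [sub_mul_szegoKernel]
  linear_combination szegoPoly N (1 + l) w * hdiff l z - szegoPoly N l w * hdiff (1 + l) z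

/-- The scaling limit of `trigKernel`. -/
noncomputable def limKernel (b c x y : ℝ) : ℂ :=
  2 * (Real.log c : ℂ) / (b * ((c : ℂ) ^ 2 - 1)) *
    Complex.exp (-(Complex.I * (Real.pi * x + Real.pi * y))) *
    (kummer (lamC c) (2 * Real.pi * Complex.I * y) *
        kummerDiff (1 + lamC c) (2 * Real.pi * Complex.I * x) (2 * Real.pi * Complex.I * y) -
      kummer (1 + lamC c) (2 * Real.pi * Complex.I * y) *
        kummerDiff (lamC c) (2 * Real.pi * Complex.I * x) (2 * Real.pi * Complex.I * y))

theorem tendsto_mul_exp_sub_one {ι : Type*} {l : Filter ι} {N : ι → ℝ} {θ : ι → ℝ} {t : ℝ}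
    (hθ : Tendsto θ l (nhds 0)) (h : Tendsto (fun i => N i * θ i) l (nhds t)) :
    Tendsto (fun i => (N i : ℂ) * (Complex.exp (Complex.I * θ i) - 1)) l
      (nhds (t * Complex.I)) := by
  have hc : ContinuousAt (dslope Complex.exp 0) 0 :=
    continuousAt_dslope_same.2 Complex.differentiable_exp.differentiableAt
  have h0 : Tendsto (fun i => Complex.I * (θ i : ℂ)) l (nhds 0) := by
    simpa using (Complex.continuous_ofReal.tendsto _).comp hθ |>.const_mul Complex.I
  have h1 := (hc.tendsto.comp h0).mul (((Complex.continuous_ofReal.tendsto _).comp h).mul_const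
    Complex.I)
  rw [dslope_same, Complex.deriv_exp, Complex.exp_zero, one_mul] at h1
  refine h1.congr fun i => ?_
  have := sub_smul_dslope Complex.exp 0 (Complex.I * θ i)
  simp only [smul_eq_mul, sub_zero, Complex.exp_zero] at this
  simp only [Function.comp_apply]
  rw [← this]
  push_cast
  ring

theorem tendsto_trigKernel {ι : Type*} {l : Filter ι} (b c : ℝ) {n d : ι → ℕ} {θ ψ : ι → ℝ}
    {x y : ℝ} (hn : Tendsto n l atTop) (hd : Tendsto (fun i => (d i : ℝ) / n i) l (nhds 1))
    (hθ : Tendsto (fun i => n i * θ i) l (nhds (Real.pi * x)))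
    (hψ : Tendsto (fun i => n i * ψ i) l (nhds (Real.pi * y))) :
    Tendsto (fun i => (Real.pi / n i : ℂ) * trigKernel b c (d i) (ψ i) (θ i)) l
      (nhds (limKernel b c x y)) := by
  have hinv : Tendsto (fun i => ((n i : ℝ))⁻¹) l (nhds 0) :=
    (tendsto_inv_atTop_nhds_zero_nat (𝕜 := ℝ)).comp hn
  have hne : ∀ᶠ i in l, (n i : ℝ) ≠ 0 := by
    filter_upwards [hn.eventually (eventually_ne_atTop 0)] with i hi
    exact_mod_cast hi
  have hN : Tendsto (fun i => ((2 * d i + 1 : ℕ) : ℝ) / n i) l (nhds 2) := by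
    have := (hd.const_mul 2).add hinv
    rw [mul_one, add_zero] at this
    refine this.congr fun i => ?_
    push_cast
    rw [add_div, mul_div_assoc, one_div]
  have hzero {θ : ι → ℝ} {x : ℝ} (hθ : Tendsto (fun i => n i * θ i) l (nhds (Real.pi * x))) :
      Tendsto θ l (nhds 0) := by
    have := hinv.mul hθ
    rw [zero_mul] at this
    refine this.congr' ?_
    filter_upwards [hne] with i hi
    field_simp
  have hmul {r : ι → ℝ} {s : ℝ} {θ : ι → ℝ} {x : ℝ} (hr : Tendsto (fun i => r i / n i) l (nhds s))
      (hθ : Tendsto (fun i => n i * θ i) l (nhds (Real.pi * x))) :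
      Tendsto (fun i => r i * θ i) l (nhds (s * (Real.pi * x))) := by
    refine (hr.mul hθ).congr' ?_
    filter_upwards [hne] with i hi
    field_simp
  have hconf {θ : ι → ℝ} {x : ℝ} (hθ : Tendsto (fun i => n i * θ i) l (nhds (Real.pi * x))) :
      Tendsto (fun i => ((2 * d i + 1 : ℕ) : ℂ) * (Complex.exp (Complex.I * θ i) - 1)) l
        (nhds (2 * Real.pi * Complex.I * x)) := by
    have := tendsto_mul_exp_sub_one (hzero hθ) (hmul hN hθ)
    convert this using 2
    · push_cast
      ring
    · push_cast
      ring
  have hγ : ∀ k, Tendsto (fun i => descRatio (2 * d i + 1) k) l (nhds 1) := by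
    have hNtop : Tendsto (fun i => 2 * d i + 1) l atTop := by
      have hdtop : Tendsto (fun i => (d i : ℝ)) l atTop := by
        have h1 : Tendsto (fun i => ((n i : ℕ) : ℝ)) l atTop := tendsto_natCast_atTop_atTop.comp hn
        refine (hd.pos_mul_atTop one_pos h1).congr' ?_
        filter_upwards [hne] with i hi
        field_simp
      exact tendsto_atTop_mono (fun i => by omega) (tendsto_natCast_atTop_iff.1 hdtop)
    exact fun k => (tendsto_descRatio k).comp hNtop
  have hγ1 : ∀ᶠ i in l, ∀ k, ‖descRatio (2 * d i + 1) k‖ ≤ 1 :=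
    .of_forall fun i k => norm_descRatio_le_one _ _
  have hP (a : ℂ) : Tendsto (fun i => szegoPoly (2 * d i + 1) a (Complex.exp (Complex.I * ψ i))) l
      (nhds (kummer a (2 * Real.pi * Complex.I * y))) :=
    (tendsto_tsum_mul_pow a hγ1 hγ (hconf hψ)).congr fun i => (szegoPoly_eq_tsum (by omega) _ _).symm
  have hD (a : ℂ) := tendsto_tsum_mul_powDiff a hγ1 hγ (hconf hθ) (hconf hψ)
  have hexp : Tendsto (fun i => Complex.exp (-(Complex.I * d i * (θ i + ψ i)))) l
      (nhds (Complex.exp (-(Complex.I * (Real.pi * x + Real.pi * y))))) := by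
    have h1 := (hmul hd hθ).add (hmul hd hψ)
    have h2 := (Complex.continuous_ofReal.tendsto _).comp h1
    have h3 := (h2.const_mul Complex.I).neg.cexp
    convert h3 using 2
    · simp only [Function.comp_apply]; push_cast; ring_nf
    · push_cast; ring_nf
  have hpre : Tendsto (fun i => (((2 * d i + 1 : ℕ) : ℝ) / n i : ℂ)) l (nhds 2) := by
    have := (Complex.continuous_ofReal.tendsto _).comp hN
    convert this using 2 <;> simp
  have hmain := ((hpre.const_mul (Real.log c / (b * ((c : ℂ) ^ 2 - 1)))).mul hexp).mul
    (((hP (lamC c)).mul (hD (1 + lamC c))).sub ((hP (1 + lamC c)).mul (hD (lamC c))))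
  convert hmain using 2 with i
  · rw [trigKernel, szegoKernel_eq (by omega), lamC]
    have hpi : (Real.pi : ℂ) ≠ 0 := by exact_mod_cast Real.pi_ne_zero
    have hI := Complex.I_ne_zero
    push_cast
    field_simp
  · rw [limKernel]
    ring

theorem limKernel_of_ne (b c : ℝ) {x y : ℝ} (hxy : x ≠ y) : limKernel b c x y =
    (1 / ((b : ℂ) * (Real.pi : ℂ) * Complex.I)) *
        (((Real.log c : ℝ) : ℂ) / ((c : ℂ) ^ 2 - 1)) *
        ((Gfun (1 + lamC c) (2 * (Real.pi : ℂ) * Complex.I * (x : ℂ)) *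
            Gfun (lamC c) (2 * (Real.pi : ℂ) * Complex.I * (y : ℂ)) -
          Gfun (1 + lamC c) (2 * (Real.pi : ℂ) * Complex.I * (y : ℂ)) *
            Gfun (lamC c) (2 * (Real.pi : ℂ) * Complex.I * (x : ℂ))) / ((x : ℂ) - (y : ℂ))) := by
  have hxy' : (x : ℂ) - y ≠ 0 := sub_ne_zero.2 (by exact_mod_cast hxy)
  have hpi : (Real.pi : ℂ) ≠ 0 := by exact_mod_cast Real.pi_ne_zero
  have he : Complex.exp (-(Complex.I * (Real.pi * x + Real.pi * y))) =
      Complex.exp (-(2 * Real.pi * Complex.I * x) / 2) *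
        Complex.exp (-(2 * Real.pi * Complex.I * y) / 2) := by
    rw [← Complex.exp_add]; ring_nf
  have h1 := sub_mul_kummerDiff (1 + lamC c) (2 * Real.pi * Complex.I * x)
    (2 * Real.pi * Complex.I * y)
  have h2 := sub_mul_kummerDiff (lamC c) (2 * Real.pi * Complex.I * x)
    (2 * Real.pi * Complex.I * y)
  have hd : (2 * Real.pi * Complex.I * x - 2 * Real.pi * Complex.I * y : ℂ) ≠ 0 := by
    rw [← mul_sub]
    exact mul_ne_zero (mul_ne_zero (mul_ne_zero two_ne_zero hpi) Complex.I_ne_zero) hxy'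
  rw [mul_comm, ← eq_div_iff hd] at h1 h2
  simp only [limKernel, he, Gfun_eq_kummer, h1, h2]
  rw [← mul_sub]
  rcases eq_or_ne b 0 with rfl | hb
  · simp
  rcases eq_or_ne ((c : ℂ) ^ 2 - 1) 0 with hc | hc
  · simp [hc]
  have hb' : (b : ℂ) ≠ 0 := by exact_mod_cast hb
  have hI := Complex.I_ne_zero
  field_simp
  ring

theorem limKernel_self (b c x : ℝ) : limKernel b c x x =
    (2 / (b : ℂ)) * (((Real.log c : ℝ) : ℂ) / ((c : ℂ) ^ 2 - 1)) *
        (deriv (Gfun (1 + lamC c)) (2 * (Real.pi : ℂ) * Complex.I * (x : ℂ)) *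
            Gfun (lamC c) (2 * (Real.pi : ℂ) * Complex.I * (x : ℂ)) -
          Gfun (1 + lamC c) (2 * (Real.pi : ℂ) * Complex.I * (x : ℂ)) *
            deriv (Gfun (lamC c)) (2 * (Real.pi : ℂ) * Complex.I * (x : ℂ))) := by
  have he : Complex.exp (-(Complex.I * (Real.pi * x + Real.pi * x))) =
      Complex.exp (-(2 * Real.pi * Complex.I * x) / 2) *
        Complex.exp (-(2 * Real.pi * Complex.I * x) / 2) := by
    rw [← Complex.exp_add]; ring_nf
  rw [limKernel, he, deriv_Gfun, deriv_Gfun, Gfun_eq_kummer, Gfun_eq_kummer, mul_div_mul_comm]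
  ring

theorem tendsto_nat_sqrt_atTop : Tendsto Nat.sqrt atTop atTop :=
  tendsto_atTop.2 fun b => (eventually_ge_atTop (b * b)).mono fun _ hn => Nat.le_sqrt.2 hn

theorem tendsto_nat_sqrt_div : Tendsto (fun n : ℕ => (Nat.sqrt n : ℝ) / n) atTop (nhds 0) := by
  refine squeeze_zero' (.of_forall fun n => by positivity) ?_
    ((tendsto_inv_atTop_nhds_zero_nat (𝕜 := ℝ)).comp tendsto_nat_sqrt_atTop)
  filter_upwards [eventually_ge_atTop 1] with n hn
  have h1 : 0 < Nat.sqrt n := Nat.sqrt_pos.2 hn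
  have h2 : ((Nat.sqrt n : ℕ) : ℝ) * Nat.sqrt n ≤ n := by exact_mod_cast Nat.sqrt_le n
  have h3 : (0 : ℝ) < Nat.sqrt n := by exact_mod_cast h1
  have h4 : (0 : ℝ) < n := by exact_mod_cast hn
  simp only [Function.comp_apply]
  rw [div_le_iff₀ h4, inv_mul_eq_div, le_div_iff₀ h3]
  exact h2

section

variable {ι : Type*} {l : Filter ι} {n : ι → ℕ}

theorem tendsto_zero_of_natCast_mul (hn : Tendsto n l atTop) {u : ι → ℝ} {t : ℝ}
    (hu : Tendsto (fun i => n i * u i) l (nhds t)) : Tendsto u l (nhds 0) := by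
  have := ((tendsto_inv_atTop_nhds_zero_nat (𝕜 := ℝ)).comp hn).mul hu
  rw [zero_mul] at this
  refine this.congr' ?_
  filter_upwards [hn.eventually (eventually_ne_atTop 0)] with i hi
  have : (n i : ℝ) ≠ 0 := by exact_mod_cast hi
  simp only [Function.comp_apply]
  field_simp

theorem tendsto_needle (hn : Tendsto n l atTop) {θ : ι → ℝ} {t : ℝ}
    (hθ : Tendsto (fun i => n i * θ i) l (nhds t)) (L : ℕ) :
    Tendsto (fun i => needle L (Nat.sqrt (n i)) (θ i)) l (nhds 1) := by
  have h0 := tendsto_zero_of_natCast_mul hn hθ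
  have hcos : Tendsto (fun i => Real.cos (θ i)) l (nhds 1) := by
    simpa [Function.comp_def] using (Real.continuous_cos.tendsto 0).comp h0
  have h1 : Tendsto (fun i => (Nat.sqrt (n i) : ℝ) / n i * (n i * θ i) * θ i) l (nhds (0 * t * 0)) :=
    ((tendsto_nat_sqrt_div.comp hn).mul hθ).mul h0
  have h2 := (hcos.pow (2 * L)).mul (h1.const_sub 1)
  rw [one_pow, mul_zero, sub_zero, mul_one] at h2
  refine tendsto_of_tendsto_of_tendsto_of_le_of_le' h2 tendsto_const_nhds ?_
    (.of_forall fun i => needle_le_one _ _ _)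
  filter_upwards [hn.eventually (eventually_ne_atTop 0)] with i hi
  have hi' : (n i : ℝ) ≠ 0 := by exact_mod_cast hi
  rw [needle]
  refine mul_le_mul_of_nonneg_left ?_ (by rw [pow_mul]; positivity)
  have hb := one_add_mul_le_pow (a := (Real.cos (θ i) - 1) / 2)
    (by linarith [Real.neg_one_le_cos (θ i)]) (Nat.sqrt (n i))
  have he : 1 + (Real.cos (θ i) - 1) / 2 = (1 + Real.cos (θ i)) / 2 := by ring
  rw [he] at hb
  refine le_trans ?_ hb
  have hc := Real.one_sub_sq_div_two_le_cos (x := θ i)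
  have he2 : (Nat.sqrt (n i) : ℝ) / n i * (n i * θ i) * θ i = Nat.sqrt (n i) * θ i ^ 2 := by
    field_simp
  rw [he2]
  nlinarith [mul_nonneg (Nat.cast_nonneg (Nat.sqrt (n i)) : (0 : ℝ) ≤ _) (sq_nonneg (θ i)),
    mul_le_mul_of_nonneg_left hc (Nat.cast_nonneg (Nat.sqrt (n i)) : (0 : ℝ) ≤ _)]

theorem cdKernel_comm (p : ℕ → Polynomial ℝ) (n : ℕ) (x y : ℝ) :
    cdKernel p n x y = cdKernel p n y x :=
  Finset.sum_congr rfl fun _ _ => mul_comm _ _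

theorem tendsto_add_sqrt_div (hn : Tendsto n l atTop) (M : ℕ) :
    Tendsto (fun i => ((n i + (M + Nat.sqrt (n i)) : ℕ) : ℝ) / n i) l (nhds 1) := by
  have h := (((tendsto_inv_atTop_nhds_zero_nat (𝕜 := ℝ)).comp hn).const_mul (M : ℝ)).add
    (tendsto_nat_sqrt_div.comp hn) |>.const_add 1
  rw [mul_zero, add_zero, add_zero] at h
  refine h.congr' ?_
  filter_upwards [hn.eventually (eventually_ne_atTop 0)] with i hi
  have hi' : (n i : ℝ) ≠ 0 := by exact_mod_cast hi
  simp only [Function.comp_apply]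
  push_cast
  field_simp

theorem eventually_add_sqrt_le (hn : Tendsto n l atTop) (M : ℕ) :
    ∀ᶠ i in l, M + Nat.sqrt (n i) ≤ n i := by
  have h := (tendsto_add_sqrt_div hn M).eventually (gt_mem_nhds one_lt_two)
  filter_upwards [h, hn.eventually (eventually_gt_atTop 0)] with i hi h0
  have h0' : (0 : ℝ) < n i := by exact_mod_cast h0
  rw [div_lt_iff₀ h0'] at hi
  have : n i + (M + Nat.sqrt (n i)) < 2 * n i := by exact_mod_cast hi
  omega

theorem tendsto_sub_sqrt_div (hn : Tendsto n l atTop) (M : ℕ) :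
    Tendsto (fun i => ((n i - (M + Nat.sqrt (n i)) : ℕ) : ℝ) / n i) l (nhds 1) := by
  have h := (tendsto_add_sqrt_div hn M).const_sub 2
  norm_num at h
  refine h.congr' ?_
  filter_upwards [eventually_add_sqrt_le hn M, hn.eventually (eventually_ne_atTop 0)] with i hi h0
  have h0' : (n i : ℝ) ≠ 0 := by exact_mod_cast h0
  rw [Nat.cast_sub hi]
  push_cast
  field_simp
  ring

theorem tendsto_re_trigKernel_self (b c : ℝ) {d : ι → ℕ} {θ : ι → ℝ}
    {x : ℝ} (hn : Tendsto n l atTop) (hd : Tendsto (fun i => (d i : ℝ) / n i) l (nhds 1))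
    (hθ : Tendsto (fun i => n i * θ i) l (nhds (Real.pi * x))) :
    Tendsto (fun i => Real.pi / n i * (trigKernel b c (d i) (θ i) (θ i)).re) l
      (nhds (limKernel b c x x).re) := by
  refine ((Complex.continuous_re.tendsto _).comp (tendsto_trigKernel b c hn hd hθ hθ)).congr
    fun i => ?_
  simp only [Function.comp_apply]
  rw [← Complex.re_ofReal_mul]
  push_cast
  rfl

theorem tendsto_cdKernel_sin {h : ℝ → ℝ} (hh : ContinuousOn h (Icc (-1) 1)) {α β c : ℝ}
    (hc : 0 < c) (hc1 : c ≠ 1) (h_pos : ∀ x ∈ Icc (-1 : ℝ) 1, 0 < h x)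
    {p : ℕ → Polynomial ℝ} (hp_deg : ∀ n, (p n).natDegree = n)
    (hp_lead : ∀ n, 0 < (p n).leadingCoeff)
    (hp_orth : ∀ m n : ℕ, ∫ x in Ioo (-1 : ℝ) 1, (p m).eval x * (p n).eval x *
      jumpWeight h α β c x = if m = n then 1 else 0)
    (hn : Tendsto n l atTop) {θ ψ : ι → ℝ} {x y : ℝ}
    (hθ : Tendsto (fun i => n i * θ i) l (nhds (Real.pi * x)))
    (hψ : Tendsto (fun i => n i * ψ i) l (nhds (Real.pi * y))) :
    Tendsto (fun i => ((Real.pi / n i *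
      cdKernel p (n i) (Real.sin (θ i)) (Real.sin (ψ i)) : ℝ) : ℂ)) l
      (nhds (limKernel (h 0) c x y)) := by
  have h0 := h_pos 0 (by norm_num)
  have hint := integrableOn_of_orthonormal hp_deg hp_orth
  obtain ⟨L, hL⟩ := exists_needle_comparison hh hc h_pos hint
  have hSθ := tendsto_needle hn hθ L
  have hSψ := tendsto_needle hn hψ L
  have hcos : Tendsto (fun i => Real.cos (ψ i)) l (nhds 1) := by
    simpa [Function.comp_def] using (Real.continuous_cos.tendsto 0).comp (tendsto_zero_of_natCast_mul hn hψ)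
  have hdp := tendsto_add_sqrt_div hn (2 * L)
  have hdm := tendsto_sub_sqrt_div hn (2 * L + 2)
  have hA := tendsto_re_trigKernel_self (h 0) c hn hdp hθ
  have hB := tendsto_re_trigKernel_self (h 0) c hn hdp hψ
  have hB' := tendsto_re_trigKernel_self (h 0) c hn hdm hψ
  have hT := tendsto_trigKernel (h 0) c hn hdp hθ hψ
  set A := (limKernel (h 0) c x x).re
  set B := (limKernel (h 0) c y y).re
  set E : ι → ℂ := fun i => (Real.pi / n i : ℂ) *
    (((cdKernel p (n i) (Real.sin (ψ i)) (Real.sin (θ i)) *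
      needle L (Nat.sqrt (n i)) (θ i) : ℝ) : ℂ) -
      trigKernel (h 0) c (n i + (2 * L + Nat.sqrt (n i))) (ψ i) (θ i)) with hE
  have key : ∀ ε ∈ Ioo (0 : ℝ) 1, ∀ᶠ i in l, ‖E i‖ ^ 2 ≤
      (Real.pi / n i * (trigKernel (h 0) c (n i + (2 * L + Nat.sqrt (n i))) (θ i) (θ i)).re) *
      (Real.pi / n i * (trigKernel (h 0) c (n i + (2 * L + Nat.sqrt (n i))) (ψ i) (ψ i)).re -
        (2 * needle L (Nat.sqrt (n i)) (ψ i) - (1 + ε)) / (1 + ε) *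
        (Real.pi / n i *
          (trigKernel (h 0) c (n i - (2 * L + 2 + Nat.sqrt (n i))) (ψ i) (ψ i)).re *
          (needle L (Nat.sqrt (n i)) (ψ i) * Real.cos (ψ i)) ^ 2)) := by
    intro ε hε
    have hs := (hSψ.const_mul 2).sub_const (1 + ε)
    filter_upwards [(tendsto_nat_sqrt_atTop.comp hn).eventually (hL ε hε.1),
      hcos.eventually (lt_mem_nhds one_pos), hs.eventually (lt_mem_nhds (a := 0) (by linarith [hε.2])),
      eventually_add_sqrt_le hn (2 * L + 2), hn.eventually (eventually_gt_atTop 0)]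
      with i hi hci hsi hdi hni
    simp only [Function.comp_apply] at hi
    have h1 := norm_cdKernel_mul_needle_sub_sq_le hint hp_deg hp_orth h0 hc hc1 hi.1 (n i) (ψ i) (θ i)
    have h2 := trigKernel_self_mul_le_cdKernel hint hp_deg hp_lead hp_orth h0 hc hc1 hε.1 hi.2
      (n := n i) (d := n i - (2 * L + 2 + Nat.sqrt (n i))) (by omega) hci
    have h3 := trigKernel_self_nonneg h0 hc hc1 (n i + (2 * L + Nat.sqrt (n i))) (θ i)
    have hε1 : 0 < 1 + ε := by linarith [hε.1]
    have hni' : (0 : ℝ) < n i := by exact_mod_cast hni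
    have hr : 0 < Real.pi / n i := div_pos Real.pi_pos hni'
    set s := 2 * needle L (Nat.sqrt (n i)) (ψ i) - (1 + ε)
    have h4 : s / (1 + ε) * ((trigKernel (h 0) c (n i - (2 * L + 2 + Nat.sqrt (n i)))
          (ψ i) (ψ i)).re * (needle L (Nat.sqrt (n i)) (ψ i) * Real.cos (ψ i)) ^ 2) ≤
        s * cdKernel p (n i) (Real.sin (ψ i)) (Real.sin (ψ i)) := by
      rw [div_mul_eq_mul_div, div_le_iff₀ hε1]
      nlinarith [mul_le_mul_of_nonneg_left h2 hsi.le]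
    have hnorm : ‖(Real.pi / n i : ℂ)‖ = Real.pi / n i := by
      rw [norm_div, Complex.norm_natCast, Complex.norm_real, Real.norm_of_nonneg Real.pi_pos.le]
    rw [hE]
    simp only
    rw [norm_mul, hnorm, mul_pow]
    refine (mul_le_mul_of_nonneg_left (h1.trans (mul_le_mul_of_nonneg_left
      (sub_le_sub_left h4 _) h3)) (sq_nonneg _)).trans (le_of_eq ?_)
    ring
  have hE0 : Tendsto (fun i => ‖E i‖ ^ 2) l (nhds 0) := by
    refine tendsto_order.2 ⟨fun a ha => .of_forall fun i => ha.trans_le (sq_nonneg _),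
      fun η hη => ?_⟩
    have hlim : Tendsto (fun ε : ℝ => A * (B - (2 * 1 - (1 + ε)) / (1 + ε) * (B * (1 * 1) ^ 2)))
        (nhdsWithin 0 (Ioi 0)) (nhds 0) := by
      have hcont : ContinuousAt
          (fun ε : ℝ => A * (B - (2 * 1 - (1 + ε)) / (1 + ε) * (B * (1 * 1) ^ 2))) 0 := by
        refine continuousAt_const.mul (continuousAt_const.sub (ContinuousAt.mul
          (ContinuousAt.div ?_ ?_ (by norm_num)) continuousAt_const)) <;> fun_prop
      have := hcont.tendsto
      norm_num at this
      refine (this.mono_left nhdsWithin_le_nhds).congr fun ε => by norm_num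
    obtain ⟨ε, hεη, hε⟩ := ((hlim.eventually (gt_mem_nhds hη)).and
      (Ioo_mem_nhdsGT (zero_lt_one' ℝ))).exists
    have hbd := hA.mul (hB.sub ((((hSψ.const_mul 2).sub_const (1 + ε)).div_const (1 + ε)).mul
      (hB'.mul ((hSψ.mul hcos).pow 2))))
    filter_upwards [key ε hε, hbd.eventually (gt_mem_nhds hεη)] with i h1 h2
    exact h1.trans_lt h2
  have hE1 : Tendsto E l (nhds 0) := by
    rw [tendsto_zero_iff_norm_tendsto_zero]
    have := hE0.sqrt
    simpa using this
  have hS : Tendsto (fun i => ((needle L (Nat.sqrt (n i)) (θ i) : ℝ) : ℂ)) l (nhds 1) := by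
    simpa [Function.comp_def] using (Complex.continuous_ofReal.tendsto _).comp hSθ
  have hfin := (hE1.add hT).div hS one_ne_zero
  rw [zero_add, div_one] at hfin
  refine hfin.congr' ?_
  filter_upwards [hSθ.eventually (lt_mem_nhds one_pos)] with i hi
  have hi' : ((needle L (Nat.sqrt (n i)) (θ i) : ℝ) : ℂ) ≠ 0 := by exact_mod_cast hi.ne'
  rw [Pi.div_apply, div_eq_iff hi', hE, cdKernel_comm p _ (Real.sin (θ i))]
  push_cast
  ring

theorem tendsto_natCast_mul_arcsin (hn : Tendsto n l atTop) {u : ι → ℝ} {t : ℝ}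
    (hu : Tendsto u l (nhds t)) :
    Tendsto (fun i => n i * Real.arcsin (u i / n i)) l (nhds t) := by
  have hd : HasDerivAt Real.arcsin 1 0 := by
    simpa using Real.hasDerivAt_arcsin (x := 0) (by norm_num) (by norm_num)
  have hz : Tendsto (fun i => u i / n i) l (nhds 0) :=
    hu.div_atTop (tendsto_natCast_atTop_atTop.comp hn)
  have hs := (continuousAt_dslope_same.2 hd.differentiableAt).tendsto.comp hz |>.mul hu
  rw [dslope_same, hd.deriv, one_mul] at hs
  refine hs.congr' ?_
  filter_upwards [hn.eventually (eventually_ne_atTop 0)] with i hi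
  have hi' : (n i : ℝ) ≠ 0 := by exact_mod_cast hi
  have := sub_smul_dslope Real.arcsin 0 (u i / n i)
  simp only [smul_eq_mul, sub_zero, Real.arcsin_zero] at this
  simp only [Function.comp_apply]
  rw [← this]
  field_simp

theorem eventually_sin_arcsin_div (hn : Tendsto n l atTop) {u : ι → ℝ} {t : ℝ}
    (hu : Tendsto u l (nhds t)) :
    ∀ᶠ i in l, Real.sin (Real.arcsin (u i / n i)) = u i / n i := by
  have hz : Tendsto (fun i => u i / n i) l (nhds 0) :=
    hu.div_atTop (tendsto_natCast_atTop_atTop.comp hn)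
  filter_upwards [hz.eventually (Icc_mem_nhds (a := -1) (b := 1) (by norm_num) (by norm_num))]
    with i hi
  exact Real.sin_arcsin hi.1 hi.2

theorem tendsto_cdKernel {h : ℝ → ℝ} (hh : ContinuousOn h (Icc (-1) 1)) {α β c : ℝ}
    (hc : 0 < c) (hc1 : c ≠ 1) (h_pos : ∀ x ∈ Icc (-1 : ℝ) 1, 0 < h x)
    {p : ℕ → Polynomial ℝ} (hp_deg : ∀ n, (p n).natDegree = n)
    (hp_lead : ∀ n, 0 < (p n).leadingCoeff)
    (hp_orth : ∀ m n : ℕ, ∫ x in Ioo (-1 : ℝ) 1, (p m).eval x * (p n).eval x *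
      jumpWeight h α β c x = if m = n then 1 else 0)
    (hn : Tendsto n l atTop) {x y : ι → ℝ} {x₀ y₀ : ℝ}
    (hx : Tendsto x l (nhds x₀)) (hy : Tendsto y l (nhds y₀)) :
    Tendsto (fun i => ((Real.pi / n i *
      cdKernel p (n i) (Real.pi * x i / n i) (Real.pi * y i / n i) : ℝ) : ℂ)) l
      (nhds (limKernel (h 0) c x₀ y₀)) := by
  have hx' := hx.const_mul Real.pi
  have hy' := hy.const_mul Real.pi
  refine (tendsto_cdKernel_sin hh hc hc1 h_pos hp_deg hp_lead hp_orth hn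
    (tendsto_natCast_mul_arcsin hn hx') (tendsto_natCast_mul_arcsin hn hy')).congr' ?_
  filter_upwards [eventually_sin_arcsin_div hn hx', eventually_sin_arcsin_div hn hy'] with i h1 h2
  rw [h1, h2]

end

theorem tendstoUniformlyOn_of_tendsto_prod {X E : Type*} [TopologicalSpace X] [PseudoMetricSpace E]
    {F : ℕ → X → E} {f : X → E}
    (h : ∀ q, Tendsto (fun a : ℕ × X => F a.1 a.2) (atTop ×ˢ nhds q) (nhds (f q)))
    {K : Set X} (hK : IsCompact K) : TendstoUniformlyOn F f atTop K := by
  rw [← tendstoLocallyUniformlyOn_iff_tendstoUniformlyOn_of_compact hK,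
    Metric.tendstoLocallyUniformlyOn_iff]
  intro ε hε q _
  obtain ⟨s, hs, t, ht, hst⟩ := mem_prod_iff.1
    ((h q).eventually (Metric.ball_mem_nhds (f q) (half_pos hε)))
  have hF : ∀ n ∈ s, ∀ y ∈ t, dist (F n y) (f q) < ε / 2 := fun n hn y hy => @hst (n, y) ⟨hn, hy⟩
  have hpt (y : X) : Tendsto (fun n => F n y) atTop (nhds (f y)) :=
    (h y).comp (tendsto_id.prodMk tendsto_const_nhds)
  refine ⟨t, mem_nhdsWithin_of_mem_nhds ht, ?_⟩
  filter_upwards [hs] with n hn y hy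
  have h1 : dist (f y) (f q) ≤ ε / 2 := le_of_tendsto ((hpt y).dist tendsto_const_nhds)
    (mem_of_superset hs fun k hk => (hF k hk y hy).le)
  have h2 := hF n hn y hy
  rw [dist_comm] at h2
  linarith [dist_triangle (f y) (f q) (F n y)]

theorem stmt8
    (α β c : ℝ) (hα : -1 < α) (hβ : -1 < β) (hc : 0 < c) (hc1 : c ≠ 1)
    (h : ℝ → ℝ)
    (h_an : AnalyticOnNhd ℝ h (Icc (-1) 1))
    (h_pos : ∀ x ∈ Icc (-1 : ℝ) 1, 0 < h x)
    -- the weight w_c(x) = h(x)(1-x)^α(1+x)^β Ξ_c(x)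
    (w : ℝ → ℝ)
    (hw : ∀ x : ℝ, w x = h x * (1 - x) ^ α * (1 + x) ^ β * (if x < 0 then 1 else c ^ 2))
    -- the orthonormal polynomials with respect to w_c
    (p : ℕ → Polynomial ℝ)
    (hp_deg : ∀ n, (p n).natDegree = n)
    (hp_lead : ∀ n, 0 < (p n).leadingCoeff)
    (hp_orth : ∀ m n : ℕ,
      ∫ x in (-1 : ℝ)..1, (p m).eval x * (p n).eval x * w x = if m = n then 1 else 0)
    -- the limit kernel K_∞
    (Kinf : ℝ → ℝ → ℂ)
    (hKinf_ne : ∀ x y : ℝ, x ≠ y → Kinf x y =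
      (1 / ((h 0 : ℂ) * (Real.pi : ℂ) * Complex.I)) *
        (((Real.log c : ℝ) : ℂ) / ((c : ℂ) ^ 2 - 1)) *
        ((Gfun (1 + lamC c) (2 * (Real.pi : ℂ) * Complex.I * (x : ℂ)) *
            Gfun (lamC c) (2 * (Real.pi : ℂ) * Complex.I * (y : ℂ)) -
          Gfun (1 + lamC c) (2 * (Real.pi : ℂ) * Complex.I * (y : ℂ)) *
            Gfun (lamC c) (2 * (Real.pi : ℂ) * Complex.I * (x : ℂ))) / ((x : ℂ) - (y : ℂ))))
    (hKinf_eq : ∀ x : ℝ, Kinf x x =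
      (2 / (h 0 : ℂ)) * (((Real.log c : ℝ) : ℂ) / ((c : ℂ) ^ 2 - 1)) *
        (deriv (Gfun (1 + lamC c)) (2 * (Real.pi : ℂ) * Complex.I * (x : ℂ)) *
            Gfun (lamC c) (2 * (Real.pi : ℂ) * Complex.I * (x : ℂ)) -
          Gfun (1 + lamC c) (2 * (Real.pi : ℂ) * Complex.I * (x : ℂ)) *
            deriv (Gfun (lamC c)) (2 * (Real.pi : ℂ) * Complex.I * (x : ℂ))))
    (δ : ℝ) (hδ : δ ∈ Ioo (0 : ℝ) 1) :
    -- locally uniformly for (x,y) ∈ (-δ,δ)², (π/n)·Kₙ(πx/n, πy/n) → K_∞(x,y)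
    ∀ K : Set (ℝ × ℝ), IsCompact K → K ⊆ (Ioo (-δ) δ) ×ˢ (Ioo (-δ) δ) →
      TendstoUniformlyOn
        (fun (n : ℕ) (q : ℝ × ℝ) =>
          ((Real.pi / n *
            ∑ k ∈ Finset.range n,
              (p k).eval (Real.pi * q.1 / n) * (p k).eval (Real.pi * q.2 / n) : ℝ) : ℂ))
        (fun q => Kinf q.1 q.2) atTop K := by
  have hwj : w = jumpWeight h α β c := funext hw
  subst hwj
  have h_orth : ∀ m n : ℕ, ∫ x in Ioo (-1 : ℝ) 1, (p m).eval x * (p n).eval x *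
      jumpWeight h α β c x = if m = n then 1 else 0 := by
    intro m n
    rw [← hp_orth m n, intervalIntegral.integral_of_le (by norm_num), integral_Ioc_eq_integral_Ioo]
  have hK : ∀ x y : ℝ, Kinf x y = limKernel (h 0) c x y := by
    intro x y
    rcases eq_or_ne x y with rfl | hxy
    · rw [hKinf_eq, limKernel_self]
    · rw [hKinf_ne x y hxy, limKernel_of_ne (h 0) c hxy]
  intro K hKc _
  refine tendstoUniformlyOn_of_tendsto_prod (fun q => ?_) hKc
  rw [hK]
  exact tendsto_cdKernel h_an.continuousOn hc hc1 h_pos hp_deg hp_lead h_orth tendsto_fst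
    (((continuous_fst.tendsto q).comp tendsto_snd)) ((continuous_snd.tendsto q).comp tendsto_snd)
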